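/- arXiv:2601.08771 — 5 statements merged into one kernel-verified Lean document; each statement's English description precedes it below -/
import Mathlib

section
/- Let u₀(x) = −1/√(−x) for x < 0 and u₀(x) = 0 for x ≥ 0, and define u : ℝ × (0,∞) → ℝ by u(x,t) = −1/√(−x) if x < 0; u(x,t) = 1/√x if 0 < x < t²/4; and u(x,t) = 0 if x ≥ t²/4 (with u(0,t) = 0). Then: (i) u satisfies the Kružkov entropy inequality for the flux f(x,u) = x·u² with initial datum u₀; and (ii) ∫_ℝ |u(x,t) − u₀(x)| dx = t for all t > 0, so in particular u(·,t) → u₀ in L¹(ℝ) as t → 0⁺. Hence u is a Kružkov entropy solution, distinct from the stationary entropy solution (x,t) ↦ u₀(x), of the same Cauchy problem. -/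
open MeasureTheory Set Filter

/-- The sign function: `1` for `s ≥ 0`, `−1` for `s < 0`. -/
noncomputable def sgn (s : ℝ) : ℝ := if 0 ≤ s then 1 else -1

/-- The initial datum `u₀(x) = −1/√(−x)` for `x < 0`, `0` for `x ≥ 0`. -/
noncomputable def uInit (x : ℝ) : ℝ := if x < 0 then -1 / Real.sqrt (-x) else 0

/-- The non-stationary solution: `u(x,t) = −1/√(−x)` for `x < 0`, `1/√x` for
`0 < x < t²/4`, and `0` otherwise (in particular `u(0,t) = 0`). -/
noncomputable def uShock (p : ℝ × ℝ) : ℝ :=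
  if p.1 < 0 then -1 / Real.sqrt (-p.1)
  else if 0 < p.1 ∧ p.1 < p.2 ^ 2 / 4 then 1 / Real.sqrt p.1
  else 0

/-- `u` satisfies the Kružkov entropy inequality for the flux `f(x,u) = x u²`
with initial datum `w₀`. -/
def EntropySol (u : ℝ × ℝ → ℝ) (w₀ : ℝ → ℝ) : Prop :=
  ∀ (k : ℝ) (φ : ℝ × ℝ → ℝ), ContDiff ℝ (⊤ : ℕ∞) φ → HasCompactSupport φ →
    (∀ p, 0 ≤ φ p) →
    0 ≤ (∫ t in Ioi (0 : ℝ), ∫ x : ℝ,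
          (|u (x, t) - k| * fderiv ℝ φ (x, t) (0, 1)
            + sgn (u (x, t) - k) * (x * (u (x, t)) ^ 2 - x * k ^ 2)
                * fderiv ℝ φ (x, t) (1, 0)
            - sgn (u (x, t) - k) * k ^ 2 * φ (x, t)))
        + ∫ x : ℝ, |w₀ x - k| * φ (x, 0)


/-- Continuous entropy flux to the left of the shock. -/
noncomputable def qLeft (k x : ℝ) : ℝ :=
  if 0 < k then |1 - max x 0 * k ^ 2| + min x 0 * k ^ 2
  else |1 + min x 0 * k ^ 2| - max x 0 * k ^ 2

theorem qLeft_continuous (k : ℝ) : Continuous (qLeft k) := by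
  unfold qLeft
  split_ifs <;> fun_prop

theorem sgn_of_nonneg {s : ℝ} (h : 0 ≤ s) : sgn s = 1 := if_pos h
theorem sgn_of_neg {s : ℝ} (h : s < 0) : sgn s = -1 := if_neg (not_le.2 h)

theorem abs_sgn (s : ℝ) : |sgn s| = 1 := by
  unfold sgn; split_ifs <;> simp

/-- sign of `1/√x - k` through `1 - x k²`, for positive `k`. -/
theorem sgn_pos_case {x k : ℝ} (hx : 0 < x) (hk : 0 < k) (_hne : 1 - x * k ^ 2 ≠ 0) :
    sgn (1 / Real.sqrt x - k) = sgn (1 - x * k ^ 2) := by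
  have hs : 0 < Real.sqrt x := Real.sqrt_pos.2 hx
  have hsq : Real.sqrt x ^ 2 = x := Real.sq_sqrt hx.le
  have e : 1 - x * k ^ 2 = (1 / Real.sqrt x - k) * (Real.sqrt x * (1 + Real.sqrt x * k)) := by
    field_simp
    ring_nf
    rw [hsq]; ring
  have hp : 0 < Real.sqrt x * (1 + Real.sqrt x * k) := by positivity
  rcases lt_or_ge (1 / Real.sqrt x - k) 0 with h | h
  · rw [sgn_of_neg h, sgn_of_neg]
    rw [e]; exact mul_neg_of_neg_of_pos h hp
  · rw [sgn_of_nonneg h, sgn_of_nonneg]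
    rw [e]; positivity

theorem sgn_neg_ne {s : ℝ} (h : s ≠ 0) : sgn (-s) = - sgn s := by
  rcases lt_or_gt_of_ne h with h | h
  · rw [sgn_of_neg h, sgn_of_nonneg (by linarith)]; norm_num
  · rw [sgn_of_nonneg h.le, sgn_of_neg (by linarith)]

theorem sgn_mul_self (s : ℝ) : sgn s * s = |s| := by
  rcases lt_or_ge s 0 with h | h
  · rw [sgn_of_neg h, abs_of_neg h]; ring
  · rw [sgn_of_nonneg h, abs_of_nonneg h]; ring

theorem hasDerivAt_abs_sgn {f : ℝ → ℝ} {f' x : ℝ} (h : HasDerivAt f f' x) (h0 : f x ≠ 0) :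
    HasDerivAt (fun y => |f y|) (sgn (f x) * f') x := by
  rcases lt_or_gt_of_ne h0 with h1 | h1
  · rw [sgn_of_neg h1]
    have := (hasDerivAt_abs_neg h1).comp x h
    exact this
  · rw [sgn_of_nonneg h1.le]
    have := (hasDerivAt_abs_pos h1).comp x h
    exact this

theorem xu_sq_pos {x : ℝ} (hx : 0 < x) : x * (1 / Real.sqrt x) ^ 2 = 1 := by
  rw [div_pow, Real.sq_sqrt hx.le]; field_simp

theorem xu_sq_neg {x : ℝ} (hx : x < 0) : x * (-1 / Real.sqrt (-x)) ^ 2 = -1 := by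
  have h0 : x ≠ 0 := hx.ne
  rw [div_pow, Real.sq_sqrt (by linarith)]; field_simp

theorem qLeft_pos {x k : ℝ} (hx : 0 < x) (hne : 1 - x * k ^ 2 ≠ 0) :
    qLeft k x = sgn (1 / Real.sqrt x - k) * (1 - x * k ^ 2) ∧
    HasDerivAt (qLeft k) (- sgn (1 / Real.sqrt x - k) * k ^ 2) x := by
  have hs : 0 < Real.sqrt x := Real.sqrt_pos.2 hx
  have hloc : ∀ᶠ y in nhds x, 0 < y := lt_mem_nhds hx
  by_cases hk : 0 < k
  · have e : ∀ y, 0 < y → qLeft k y = |1 - y * k ^ 2| := by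
      intro y hy
      simp [qLeft, hk, max_eq_left hy.le, min_eq_right hy.le]
    rw [sgn_pos_case hx hk hne]
    refine ⟨by rw [e x hx, sgn_mul_self], ?_⟩
    have hd : HasDerivAt (fun y : ℝ => 1 - y * k ^ 2) (-(1 * k ^ 2)) x :=
      ((hasDerivAt_id x).mul_const (k ^ 2)).const_sub 1
    have := (hasDerivAt_abs_sgn hd hne).congr_of_eventuallyEq
      (hloc.mono fun y hy => e y hy)
    exact this.congr_deriv (by ring)
  · have e : ∀ y, 0 < y → qLeft k y = 1 - y * k ^ 2 := by
      intro y hy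
      simp [qLeft, hk, max_eq_left hy.le, min_eq_right hy.le]
    have h1 : sgn (1 / Real.sqrt x - k) = 1 := by
      apply sgn_of_nonneg
      have : 0 < 1 / Real.sqrt x := by positivity
      linarith
    rw [h1]
    refine ⟨by rw [e x hx]; ring, ?_⟩
    have hd : HasDerivAt (fun y : ℝ => 1 - y * k ^ 2) (-(1 * k ^ 2)) x :=
      ((hasDerivAt_id x).mul_const (k ^ 2)).const_sub 1
    have := hd.congr_of_eventuallyEq (hloc.mono fun y hy => e y hy)
    exact this.congr_deriv (by ring)

theorem qLeft_neg {x k : ℝ} (hx : x < 0) (hne : 1 + x * k ^ 2 ≠ 0) :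
    qLeft k x = sgn (-1 / Real.sqrt (-x) - k) * (-1 - x * k ^ 2) ∧
    HasDerivAt (qLeft k) (- sgn (-1 / Real.sqrt (-x) - k) * k ^ 2) x := by
  have hs : 0 < Real.sqrt (-x) := Real.sqrt_pos.2 (by linarith)
  have hloc : ∀ᶠ y in nhds x, y < 0 := gt_mem_nhds hx
  have hd : HasDerivAt (fun y : ℝ => 1 + y * k ^ 2) (1 * k ^ 2) x :=
      ((hasDerivAt_id x).mul_const (k ^ 2)).const_add 1
  by_cases hk : 0 ≤ k
  · have e : ∀ y, y < 0 → qLeft k y = 1 + y * k ^ 2 := by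
      intro y hy
      rcases hk.eq_or_lt with h | h
      · subst h; simp [qLeft]
      simp [qLeft, h, max_eq_right hy.le, min_eq_left hy.le]
    have h1 : sgn (-1 / Real.sqrt (-x) - k) = -1 := by
      apply sgn_of_neg
      have : 0 < 1 / Real.sqrt (-x) := by positivity
      rw [neg_div]
      linarith
    rw [h1]
    refine ⟨by rw [e x hx]; ring, ?_⟩
    have := hd.congr_of_eventuallyEq (hloc.mono fun y hy => e y hy)
    exact this.congr_deriv (by ring)
  · push Not at hk
    have e : ∀ y, y < 0 → qLeft k y = |1 + y * k ^ 2| := by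
      intro y hy
      simp [qLeft, not_lt.2 hk.le, max_eq_right hy.le, min_eq_left hy.le]
    have hne' : 1 - (-x) * (-k) ^ 2 ≠ 0 := by
      intro h; apply hne; rw [← h]; ring
    have h2 := sgn_pos_case (x := -x) (k := -k) (by linarith) (by linarith) hne'
    have e3 : 1 - (-x) * (-k) ^ 2 = 1 + x * k ^ 2 := by ring
    have hne4 : 1 / Real.sqrt (-x) - -k ≠ 0 := by
      intro h
      apply hne'
      have h5 : -k = 1 / Real.sqrt (-x) := by linarith
      rw [h5, xu_sq_pos (by linarith)]; ring
    have h1 : sgn (-1 / Real.sqrt (-x) - k) = - sgn (1 + x * k ^ 2) := by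
      rw [← e3, ← h2, ← sgn_neg_ne hne4]
      congr 1; ring
    rw [h1]
    refine ⟨by rw [e x hx, ← sgn_mul_self]; ring, ?_⟩
    have := (hasDerivAt_abs_sgn hd hne).congr_of_eventuallyEq
      (hloc.mono fun y hy => e y hy)
    exact this.congr_deriv (by ring)

/-- pointwise sign of the shock contribution -/
theorem shock_sign (k t : ℝ) (ht : 0 < t) :
    0 ≤ (t / 2) * (|k| - |2 / t - k|) + (qLeft k (t ^ 2 / 4) + sgn (-k) * (t ^ 2 / 4 * k ^ 2)) := by
  have hx : (0:ℝ) < t ^ 2 / 4 := by positivity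
  have e1 : (t / 2) * |2 / t - k| = |1 - t / 2 * k| := by
    rw [← abs_of_pos (show 0 < t / 2 by positivity), ← abs_mul, abs_of_pos (show 0 < t / 2 by positivity)]
    congr 1; field_simp
  rw [mul_sub, e1]
  by_cases hk : 0 < k
  · rw [sgn_of_neg (by linarith), abs_of_pos hk]
    simp only [qLeft, hk, if_true, max_eq_left hx.le, min_eq_right hx.le]
    have e2 : t ^ 2 / 4 * k ^ 2 = (t / 2 * k) ^ 2 := by ring
    rw [e2]
    have hy : 0 < t / 2 * k := by positivity
    set y := t / 2 * k
    rcases le_total y 1 with h | h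
    · rw [abs_of_nonneg (by linarith), abs_of_nonneg (by nlinarith)]
      nlinarith
    · rw [abs_of_nonpos (by linarith), abs_of_nonpos (by nlinarith)]
      nlinarith
  · push Not at hk
    rw [sgn_of_nonneg (by linarith), abs_of_nonpos hk]
    have : t / 2 * k ≤ 0 := mul_nonpos_of_nonneg_of_nonpos (by positivity) hk
    simp only [qLeft, not_lt.2 hk, if_false, max_eq_left hx.le, min_eq_right hx.le]
    rw [abs_of_nonneg (by linarith)]
    simp only [zero_mul, add_zero, abs_one, mul_neg]
    linarith

theorem sqrt_inv_intOn (a b : ℝ) : IntervalIntegrable (fun x : ℝ => 1 / Real.sqrt x) volume a b := by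
  have key : ∀ c : ℝ, IntervalIntegrable (fun x : ℝ => 1 / Real.sqrt x) volume 0 c := by
    intro c
    rcases le_total 0 c with h | h
    · have := intervalIntegral.intervalIntegrable_rpow' (a := 0) (b := c) (r := -(1/2)) (by norm_num)
      refine this.congr ?_
      intro x hx
      rw [uIoc_of_le h] at hx
      simp only
      rw [Real.rpow_neg hx.1.le, Real.sqrt_eq_rpow, one_div (x ^ _)]
    · refine (IntervalIntegrable.symm ?_)
      have : IntervalIntegrable (fun x : ℝ => (0:ℝ)) volume c 0 := by simp
      refine this.congr ?_
      intro x hx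
      rw [uIoc_of_le h] at hx
      simp [Real.sqrt_eq_zero_of_nonpos hx.2]
  exact (key a).symm.trans (key b)

theorem part_two (t : ℝ) (ht : 0 < t) : ∫ x : ℝ, |uShock (x, t) - uInit x| = t := by
  have e : (fun x : ℝ => |uShock (x, t) - uInit x|) =
      (Ioo 0 (t ^ 2 / 4)).indicator (fun x => x ^ (-(1/2) : ℝ)) := by
    funext x
    by_cases h : x ∈ Ioo 0 (t ^ 2 / 4)
    · rw [indicator_of_mem h]
      have h1 : ¬ x < 0 := not_lt.2 h.1.le
      simp only [uShock, uInit, h1, if_false]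
      rw [if_pos ⟨h.1, h.2⟩, sub_zero, abs_of_nonneg (by positivity), Real.rpow_neg h.1.le,
        Real.sqrt_eq_rpow, one_div]
    · rw [indicator_of_notMem h]
      simp only [uShock, uInit]
      by_cases h1 : x < 0
      · simp [h1]
      · simp only [h1, if_false]
        rw [if_neg (fun hh => h ⟨hh.1, hh.2⟩)]; simp
  have hp : (0:ℝ) ≤ t ^ 2 / 4 := by positivity
  rw [e, integral_indicator measurableSet_Ioo, ← integral_Ioc_eq_integral_Ioo,
    ← intervalIntegral.integral_of_le hp, integral_rpow (Or.inl (by norm_num))]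
  have e2 : (t ^ 2 / 4 : ℝ) = (t / 2) ^ 2 := by ring
  rw [show (-(1/2) + 1 : ℝ) = 1/2 by norm_num, ← Real.sqrt_eq_rpow, e2, Real.sqrt_sq (by positivity)]
  rw [Real.zero_rpow (by norm_num)]
  ring

theorem measurable_uShock : Measurable uShock := by
  unfold uShock
  refine Measurable.ite (measurableSet_lt measurable_fst measurable_const) (by fun_prop) ?_
  refine Measurable.ite ?_ (by fun_prop) (by fun_prop)
  exact (measurableSet_lt measurable_const measurable_fst).inter
    (measurableSet_lt measurable_fst (by fun_prop))

theorem measurable_uInit : Measurable uInit := by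
  unfold uInit
  exact Measurable.ite (measurableSet_lt measurable_id measurable_const) (by fun_prop) (by fun_prop)

theorem measurable_sgn : Measurable sgn := by
  unfold sgn
  exact Measurable.ite (measurableSet_le measurable_const measurable_id) (by fun_prop) (by fun_prop)

theorem uInit_eq (x : ℝ) : uInit x = -1 / Real.sqrt (-x) := by
  unfold uInit
  split_ifs with h
  · rfl
  · rw [Real.sqrt_eq_zero_of_nonpos (by linarith)]; simp

theorem abs_uShock_le (p : ℝ × ℝ) : |uShock p| ≤ 1 / Real.sqrt p.1 + 1 / Real.sqrt (-p.1) := by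
  have h1 : 0 ≤ 1 / Real.sqrt p.1 := by positivity
  have h2 : 0 ≤ 1 / Real.sqrt (-p.1) := by positivity
  unfold uShock
  split_ifs
  · rw [neg_div, abs_neg, abs_of_nonneg h2]; linarith
  · rw [abs_of_nonneg h1]; linarith
  · simp only [abs_zero]; linarith

theorem abs_uInit_le (x : ℝ) : |uInit x| ≤ 1 / Real.sqrt x + 1 / Real.sqrt (-x) := by
  have h1 : 0 ≤ 1 / Real.sqrt x := by positivity
  have h2 : 0 ≤ 1 / Real.sqrt (-x) := by positivity
  rw [uInit_eq, neg_div, abs_neg, abs_of_nonneg h2]; linarith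

/-- `x u²` is bounded by one. -/
theorem abs_flux_le (p : ℝ × ℝ) : |p.1 * uShock p ^ 2| ≤ 1 := by
  unfold uShock
  split_ifs with h1 h2
  · rw [xu_sq_neg h1]; simp
  · rw [xu_sq_pos h2.1]; simp
  · simp

theorem cutoff {φ : ℝ × ℝ → ℝ} (hc : HasCompactSupport φ) :
    ∃ R : ℝ, 0 < R ∧ ∀ x t : ℝ, (R ≤ |x| ∨ R ≤ |t|) →
      φ (x, t) = 0 ∧ fderiv ℝ φ (x, t) = 0 := by
  obtain ⟨R, hR, hsub⟩ := hc.isCompact.isBounded.subset_ball_lt 0 (0 : ℝ × ℝ)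
  refine ⟨R, hR, fun x t h => ?_⟩
  have hn : (x, t) ∉ tsupport φ := by
    intro hm
    have := hsub hm
    rw [mem_ball_zero_iff, Prod.norm_def, max_lt_iff] at this
    simp only [Real.norm_eq_abs] at this
    rcases h with h | h <;> linarith [this.1, this.2]
  refine ⟨image_eq_zero_of_notMem_tsupport hn, ?_⟩
  by_contra h0
  exact hn (support_fderiv_subset ℝ h0)

/-- The weight dominating all states. -/
noncomputable def wgt (x : ℝ) : ℝ := 1 / Real.sqrt x + 1 / Real.sqrt (-x)

theorem wgt_nonneg (x : ℝ) : 0 ≤ wgt x := by unfold wgt; positivity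

theorem wgt_int (R K C : ℝ) (hR : 0 < R) :
    Integrable ((Ioc (-R) R).indicator (fun x => (wgt x + K) * C)) volume := by
  rw [integrable_indicator_iff measurableSet_Ioc]
  have h1 := sqrt_inv_intOn (-R) R
  have h2 : IntervalIntegrable (fun x : ℝ => 1 / Real.sqrt (-x)) volume (-R) R := by
    have h := (IntervalIntegrable.comp_sub_left (sqrt_inv_intOn R (-R)) 0)
    simpa using h
  have h3 : IntervalIntegrable (fun x => (wgt x + K) * C) volume (-R) R :=
    ((h1.add h2).add intervalIntegrable_const).mul_const C
  rwa [intervalIntegrable_iff_integrableOn_Ioc_of_le (by linarith)] at h3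

theorem mem_Ioc_of_abs {x R : ℝ} (h : ¬ R ≤ |x|) : x ∈ Ioc (-R) R := by
  push Not at h
  rw [abs_lt] at h
  exact ⟨h.1, h.2.le⟩

theorem dom1 {h : ℝ → ℝ} (hm : Measurable h) {R K C : ℝ} (hR : 0 < R) (hK : 0 ≤ K) (hC : 0 ≤ C)
    (h0 : ∀ x, R ≤ |x| → h x = 0) (hb : ∀ x, |x| < R → |h x| ≤ (wgt x + K) * C) :
    Integrable h volume := by
  refine (wgt_int R K C hR).mono' hm.aestronglyMeasurable (ae_of_all _ fun x => ?_)
  have hnn : ∀ y, 0 ≤ (wgt y + K) * C := fun y =>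
    mul_nonneg (add_nonneg (wgt_nonneg y) hK) hC
  by_cases hx : R ≤ |x|
  · rw [h0 x hx, norm_zero]
    exact indicator_nonneg (fun y _ => hnn y) x
  · rw [indicator_of_mem (mem_Ioc_of_abs hx)]
    exact hb x (not_le.1 hx)

theorem dom2 {h : ℝ × ℝ → ℝ} (hm : Measurable h) {R K C : ℝ} (hR : 0 < R) (hK : 0 ≤ K)
    (hC : 0 ≤ C) (h0 : ∀ t x, (R ≤ |x| ∨ R ≤ |t|) → h (t, x) = 0)
    (hb : ∀ t x, |x| < R → |h (t, x)| ≤ (wgt x + K) * C) :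
    Integrable h ((volume.restrict (Ioi (0:ℝ))).prod (volume : Measure ℝ)) := by
  have i1 : Integrable ((Ioc (-R) R).indicator (fun _ : ℝ => (1:ℝ))) (volume.restrict (Ioi (0:ℝ))) := by
    refine Integrable.restrict ?_
    rw [integrable_indicator_iff measurableSet_Ioc]
    simp
  refine (i1.mul_prod (wgt_int R K C hR)).mono' hm.aestronglyMeasurable
    (ae_of_all _ fun p => ?_)
  obtain ⟨t, x⟩ := p
  have hnn : ∀ y, 0 ≤ (wgt y + K) * C := fun y =>
    mul_nonneg (add_nonneg (wgt_nonneg y) hK) hC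
  by_cases hx : R ≤ |x| ∨ R ≤ |t|
  · rw [h0 t x hx, norm_zero]
    exact mul_nonneg (indicator_nonneg (fun y _ => zero_le_one) _)
      (indicator_nonneg (fun y _ => hnn y) x)
  · rw [not_or] at hx
    simp only
    rw [indicator_of_mem (mem_Ioc_of_abs hx.1), indicator_of_mem (mem_Ioc_of_abs hx.2), one_mul]
    exact hb t x (not_le.1 hx.1)

theorem hasDerivAt_x {φ : ℝ × ℝ → ℝ} (hφ : Differentiable ℝ φ) (x t : ℝ) :
    HasDerivAt (fun y => φ (y, t)) (fderiv ℝ φ (x, t) (1, 0)) x :=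
  (hφ (x, t)).hasFDerivAt.comp_hasDerivAt x ((hasDerivAt_id x).prodMk (hasDerivAt_const x t))

theorem hasDerivAt_t {φ : ℝ × ℝ → ℝ} (hφ : Differentiable ℝ φ) (x t : ℝ) :
    HasDerivAt (fun s => φ (x, s)) (fderiv ℝ φ (x, t) (0, 1)) t :=
  (hφ (x, t)).hasFDerivAt.comp_hasDerivAt t ((hasDerivAt_const t x).prodMk (hasDerivAt_id t))

/-- time part of the entropy integrand -/
noncomputable def hA (φ : ℝ × ℝ → ℝ) (k : ℝ) (p : ℝ × ℝ) : ℝ :=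
  |uShock (p.2, p.1) - k| * fderiv ℝ φ (p.2, p.1) (0, 1)

/-- space part of the entropy integrand -/
noncomputable def hB (φ : ℝ × ℝ → ℝ) (k : ℝ) (p : ℝ × ℝ) : ℝ :=
  sgn (uShock (p.2, p.1) - k) * (p.2 * (uShock (p.2, p.1)) ^ 2 - p.2 * k ^ 2)
                * fderiv ℝ φ (p.2, p.1) (1, 0)
            - sgn (uShock (p.2, p.1) - k) * k ^ 2 * φ (p.2, p.1)

theorem hA_meas {φ : ℝ × ℝ → ℝ} (hφ : ContDiff ℝ (⊤ : ℕ∞) φ) (k : ℝ) : Measurable (hA φ k) := by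
  have c1 : Continuous (fun p => fderiv ℝ φ p (0, 1)) :=
    (hφ.continuous_fderiv (by simp)).clm_apply continuous_const
  have m1 : Measurable (fun p : ℝ × ℝ => uShock (p.2, p.1)) :=
    measurable_uShock.comp (measurable_snd.prodMk measurable_fst)
  have m2 : Measurable (fun p : ℝ × ℝ => fderiv ℝ φ (p.2, p.1) (0, 1)) :=
    c1.measurable.comp (measurable_snd.prodMk measurable_fst)
  have m3 : Measurable (fun p : ℝ × ℝ => |uShock (p.2, p.1) - k|) :=
    measurable_abs.comp (m1.sub_const k)
  exact m3.mul m2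

theorem hB_meas {φ : ℝ × ℝ → ℝ} (hφ : ContDiff ℝ (⊤ : ℕ∞) φ) (k : ℝ) : Measurable (hB φ k) := by
  have c1 : Continuous (fun p => fderiv ℝ φ p (1, 0)) :=
    (hφ.continuous_fderiv (by simp)).clm_apply continuous_const
  have m1 : Measurable (fun p : ℝ × ℝ => uShock (p.2, p.1)) :=
    measurable_uShock.comp (measurable_snd.prodMk measurable_fst)
  have m2 : Measurable (fun p : ℝ × ℝ => fderiv ℝ φ (p.2, p.1) (1, 0)) :=
    c1.measurable.comp (measurable_snd.prodMk measurable_fst)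
  have m4 : Measurable (fun p : ℝ × ℝ => φ (p.2, p.1)) :=
    hφ.continuous.measurable.comp (measurable_snd.prodMk measurable_fst)
  have m3 : Measurable (fun p : ℝ × ℝ => sgn (uShock (p.2, p.1) - k)) :=
    measurable_sgn.comp (m1.sub_const k)
  exact ((m3.mul ((measurable_snd.mul (m1.pow_const 2)).sub
    (measurable_snd.mul_const (k ^ 2)))).mul m2).sub ((m3.mul_const (k ^ 2)).mul m4)

theorem hA_bound {φ : ℝ × ℝ → ℝ} {k C : ℝ} (hC : ∀ p, |fderiv ℝ φ p (0, 1)| ≤ C) (t x : ℝ) :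
    |hA φ k (t, x)| ≤ (wgt x + |k|) * C := by
  unfold hA
  rw [abs_mul, abs_abs]
  have h1 : |uShock (x, t) - k| ≤ wgt x + |k| :=
    (abs_sub _ _).trans (add_le_add_left (abs_uShock_le (x, t)) _)
  exact mul_le_mul h1 (hC _) (abs_nonneg _) (add_nonneg (wgt_nonneg x) (abs_nonneg k))

theorem hB_bound {φ : ℝ × ℝ → ℝ} {k C R : ℝ} (hC0 : 0 ≤ C) (hC : ∀ p, |fderiv ℝ φ p (1, 0)| ≤ C)
    (hC' : ∀ p, |φ p| ≤ C) (t x : ℝ) (hx : |x| < R) :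
    |hB φ k (t, x)| ≤ (wgt x + (1 + R * k ^ 2 + k ^ 2)) * C := by
  unfold hB
  simp only
  have hk : 0 ≤ k ^ 2 := sq_nonneg k
  have h1 : |x * uShock (x, t) ^ 2 - x * k ^ 2| ≤ 1 + R * k ^ 2 := by
    refine (abs_sub _ _).trans (add_le_add (abs_flux_le (x, t)) ?_)
    rw [abs_mul, abs_of_nonneg hk]
    exact mul_le_mul_of_nonneg_right hx.le hk
  have h2 : |sgn (uShock (x, t) - k) * (x * uShock (x, t) ^ 2 - x * k ^ 2) *
      fderiv ℝ φ (x, t) (1, 0)| ≤ (1 + R * k ^ 2) * C := by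
    rw [abs_mul, abs_mul, abs_sgn, one_mul]
    exact mul_le_mul h1 (hC _) (abs_nonneg _) ((abs_nonneg _).trans h1)
  have h3 : |sgn (uShock (x, t) - k) * k ^ 2 * φ (x, t)| ≤ k ^ 2 * C := by
    rw [abs_mul, abs_mul, abs_sgn, one_mul, abs_of_nonneg hk]
    exact mul_le_mul_of_nonneg_left (hC' _) hk
  have h4 := mul_nonneg (wgt_nonneg x) hC0
  refine (abs_sub _ _).trans ?_
  nlinarith

theorem B_eval {φ : ℝ × ℝ → ℝ} (hφ : ContDiff ℝ (⊤ : ℕ∞) φ) {R : ℝ} (hR : 0 < R)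
    (hz : ∀ x t : ℝ, (R ≤ |x| ∨ R ≤ |t|) → φ (x, t) = 0 ∧ fderiv ℝ φ (x, t) = 0)
    (k t : ℝ) (ht : 0 < t) (hi : Integrable (fun x => hB φ k (t, x)) volume) :
    ∫ x, hB φ k (t, x) =
      (qLeft k (t ^ 2 / 4) + sgn (-k) * (t ^ 2 / 4 * k ^ 2)) * φ (t ^ 2 / 4, t) := by
  have hd : Differentiable ℝ φ := hφ.differentiable (by simp)
  set s := t ^ 2 / 4 with hs
  have hs0 : 0 < s := by positivity
  have hcx : Continuous (fun y => φ (y, t)) := hφ.continuous.comp (by fun_prop)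
  have hsupp : Function.support (fun x => hB φ k (t, x)) ⊆ Ioc (-R) (R + s) := by
    intro x hx
    by_contra hn
    apply hx
    have hx' : R ≤ |x| := by
      by_contra h
      have := mem_Ioc_of_abs h
      exact hn ⟨this.1, by linarith [this.2]⟩
    have := hz x t (Or.inl hx')
    simp [hB, this.1, this.2]
  rw [← intervalIntegral.integral_eq_integral_of_support_subset hsupp,
    ← intervalIntegral.integral_add_adjacent_intervals (b := s) hi.intervalIntegrable
      hi.intervalIntegrable]
  have e1 : ∫ x in (-R)..s, hB φ k (t, x) = qLeft k s * φ (s, t) - qLeft k (-R) * φ (-R, t) := by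
    refine integral_eq_of_hasDerivAt_off_countable (fun x => qLeft k x * φ (x, t)) _
      (s := {0, (k ^ 2)⁻¹, -(k ^ 2)⁻¹}) ?_ ?_ ?_ hi.intervalIntegrable
    · exact (Set.toFinite _).countable
    · exact ((qLeft_continuous k).mul hcx).continuousOn
    · rintro x ⟨hx, hx2⟩
      rw [max_eq_right (by linarith)] at hx
      simp only [mem_insert_iff, mem_singleton_iff, not_or] at hx2
      obtain ⟨h1, h2, h3⟩ := hx2
      have hxs : x < t ^ 2 / 4 := hx.2
      rcases lt_or_gt_of_ne h1 with h | h
      · have hne : 1 + x * k ^ 2 ≠ 0 := by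
          intro h0
          have hk : k ^ 2 ≠ 0 := by rintro hk; rw [hk] at h0; simp at h0
          apply h3
          have h6 : -x = (k ^ 2)⁻¹ := eq_inv_of_mul_eq_one_left (by linarith)
          linarith
        obtain ⟨q1, q2⟩ := qLeft_neg h hne
        have hu : uShock (x, t) = -1 / Real.sqrt (-x) := if_pos h
        refine (q2.mul (hasDerivAt_x hd x t)).congr_deriv ?_
        simp only [hB, hu, xu_sq_neg h, q1]
        ring
      · have hne : 1 - x * k ^ 2 ≠ 0 := by
          intro h0
          have hk : k ^ 2 ≠ 0 := by rintro hk; rw [hk] at h0; simp at h0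
          exact h2 (eq_inv_of_mul_eq_one_left (by linarith))
        obtain ⟨q1, q2⟩ := qLeft_pos h hne
        have hu : uShock (x, t) = 1 / Real.sqrt x := by
          unfold uShock
          rw [if_neg (not_lt.2 h.le), if_pos ⟨h, hxs⟩]
        refine (q2.mul (hasDerivAt_x hd x t)).congr_deriv ?_
        simp only [hB, hu, xu_sq_pos h, q1]
        ring
  have e2 : ∫ x in s..(R + s), hB φ k (t, x) =
      sgn (-k) * (-(R + s) * k ^ 2) * φ (R + s, t) - sgn (-k) * (-s * k ^ 2) * φ (s, t) := by
    refine integral_eq_of_hasDerivAt_off_countable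
      (fun x => sgn (-k) * (-x * k ^ 2) * φ (x, t)) _
      (s := ∅) Set.countable_empty ?_ ?_ hi.intervalIntegrable
    · exact (Continuous.mul (by fun_prop) hcx).continuousOn
    · rintro x ⟨hx, -⟩
      rw [min_eq_left (by linarith)] at hx
      have h0 : 0 < x := hs0.trans hx.1
      have hxs : ¬ x < t ^ 2 / 4 := not_lt.2 hx.1.le
      have hu : uShock (x, t) = 0 := by
        unfold uShock
        rw [if_neg (not_lt.2 h0.le), if_neg (fun h => hxs h.2)]
      have hdl : HasDerivAt (fun x => sgn (-k) * (-x * k ^ 2)) (sgn (-k) * (-1 * k ^ 2)) x :=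
        (((hasDerivAt_id x).neg).mul_const (k ^ 2)).const_mul (sgn (-k))
      refine (hdl.mul (hasDerivAt_x hd x t)).congr_deriv ?_
      simp only [hB, hu, zero_sub]
      ring
  have z1 : φ (-R, t) = 0 := (hz _ _ (Or.inl (by rw [abs_neg, abs_of_pos hR]))).1
  have z2 : φ (R + s, t) = 0 := (hz _ _ (Or.inl (by rw [abs_of_pos (by linarith)]; linarith))).1
  rw [e1, e2, z1, z2]
  ring

/-- shock contribution of the time part -/
noncomputable def jA (φ : ℝ × ℝ → ℝ) (k x : ℝ) : ℝ :=
  if 0 < x then (|k| - |1 / Real.sqrt x - k|) * φ (x, 2 * Real.sqrt x) else 0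

theorem A_eval {φ : ℝ × ℝ → ℝ} (hφ : ContDiff ℝ (⊤ : ℕ∞) φ) {R : ℝ} (hR : 0 < R)
    (hz : ∀ x t : ℝ, (R ≤ |x| ∨ R ≤ |t|) → φ (x, t) = 0 ∧ fderiv ℝ φ (x, t) = 0)
    (k x : ℝ) (hi : Integrable (fun t => hA φ k (t, x)) volume) :
    (∫ t in Ioi (0:ℝ), hA φ k (t, x)) + |uInit x - k| * φ (x, 0) = jA φ k x := by
  have hd : Differentiable ℝ φ := hφ.differentiable (by simp)
  have hct : Continuous (fun s => φ (x, s)) := hφ.continuous.comp (by fun_prop)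
  have key : ∀ (a b c : ℝ), a ≤ b → (∀ t ∈ Ioo a b, uShock (x, t) = c) →
      ∫ t in a..b, hA φ k (t, x) = |c - k| * φ (x, b) - |c - k| * φ (x, a) := by
    intro a b c hab hu
    refine integral_eq_of_hasDerivAt_off_countable (fun t => |c - k| * φ (x, t)) _
      (s := ∅) Set.countable_empty ?_ ?_ hi.intervalIntegrable
    · exact (continuous_const.mul hct).continuousOn
    · rintro t ⟨ht, -⟩
      rw [min_eq_left hab, max_eq_right hab] at ht
      refine ((hasDerivAt_t hd x t).const_mul (|c - k|)).congr_deriv ?_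
      simp only [hA, hu t ht]
  set T := 2 * Real.sqrt x with hT
  have hT0 : 0 ≤ T := by positivity
  have hsub : ∫ t in Ioi (0:ℝ), hA φ k (t, x) = ∫ t in (0:ℝ)..(R + T), hA φ k (t, x) := by
    rw [intervalIntegral.integral_of_le (by linarith)]
    refine setIntegral_eq_of_subset_of_forall_sdiff_eq_zero measurableSet_Ioi
      (fun y hy => hy.1) ?_
    rintro t ⟨h1, h2⟩
    have h3 : R ≤ |t| := by
      by_contra h
      exact h2 ⟨h1, by linarith [(mem_Ioc_of_abs h).2]⟩
    simp [hA, (hz x t (Or.inr h3)).2]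
  have z2 : φ (x, R + T) = 0 :=
    (hz _ _ (Or.inr (by rw [abs_of_pos (by linarith)]; linarith))).1
  rw [hsub]
  by_cases hx : 0 < x
  · have hn : ¬ x < 0 := not_lt.2 hx.le
    have hsq : Real.sqrt x ^ 2 = x := Real.sq_sqrt hx.le
    have hsp : 0 < Real.sqrt x := Real.sqrt_pos.2 hx
    rw [← intervalIntegral.integral_add_adjacent_intervals (b := T) hi.intervalIntegrable
      hi.intervalIntegrable, key 0 T 0 hT0, key T (R + T) (1 / Real.sqrt x) (by linarith), z2]
    · simp only [uInit, hn, if_false, jA, hx, if_true, zero_sub, abs_neg]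
      ring
    · intro t ht
      have : x < t ^ 2 / 4 := by
        have := ht.1
        rw [hT] at this
        nlinarith
      unfold uShock
      rw [if_neg hn, if_pos ⟨hx, this⟩]
    · intro t ht
      have : ¬ x < t ^ 2 / 4 := by
        have h1 := ht.1
        have := ht.2
        rw [hT] at this
        nlinarith
      unfold uShock
      rw [if_neg hn, if_neg (fun h => this h.2)]
  · rw [key 0 (R + T) (uInit x) (by linarith), z2]
    · simp [jA, hx]
    · intro t _
      unfold uShock uInit
      simp only [hx, false_and, if_false]

theorem entropy_part : EntropySol uShock uInit := by
  intro k φ hφ hc hnn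
  obtain ⟨R, hR, hz⟩ := cutoff hc
  have ct : Continuous (fun p => fderiv ℝ φ p (0, 1)) :=
    (hφ.continuous_fderiv (by simp)).clm_apply continuous_const
  have cx : Continuous (fun p => fderiv ℝ φ p (1, 0)) :=
    (hφ.continuous_fderiv (by simp)).clm_apply continuous_const
  obtain ⟨C1, hC1⟩ := (hc.fderiv_apply ℝ (0, 1)).exists_bound_of_continuous ct
  obtain ⟨C2, hC2⟩ := (hc.fderiv_apply ℝ (1, 0)).exists_bound_of_continuous cx
  obtain ⟨C3, hC3⟩ := hc.exists_bound_of_continuous hφ.continuous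
  simp only [Real.norm_eq_abs] at hC1 hC2 hC3
  set C := max C1 (max C2 C3) with hCdef
  have b1 : ∀ p, |fderiv ℝ φ p (0, 1)| ≤ C := fun p => (hC1 p).trans (le_max_left _ _)
  have b2 : ∀ p, |fderiv ℝ φ p (1, 0)| ≤ C := fun p =>
    (hC2 p).trans ((le_max_left _ _).trans (le_max_right _ _))
  have b3 : ∀ p, |φ p| ≤ C := fun p =>
    (hC3 p).trans ((le_max_right _ _).trans (le_max_right _ _))
  have hC0 : 0 ≤ C := (abs_nonneg _).trans (b3 0)
  have mA := hA_meas hφ k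
  have mB := hB_meas hφ k
  have zA : ∀ t x, (R ≤ |x| ∨ R ≤ |t|) → hA φ k (t, x) = 0 := by
    intro t x h
    simp [hA, (hz x t h).2]
  have zB : ∀ t x, (R ≤ |x| ∨ R ≤ |t|) → hB φ k (t, x) = 0 := by
    intro t x h
    simp [hB, (hz x t h).1, (hz x t h).2]
  have hK : 0 ≤ 1 + R * k ^ 2 + k ^ 2 := by positivity
  have iA := dom2 mA hR (abs_nonneg k) hC0 zA (fun t x _ => hA_bound b1 t x)
  have iB := dom2 mB hR hK hC0 zB (fun t x hx => hB_bound hC0 b2 b3 t x hx)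
  have sA : ∀ x, Integrable (fun t => hA φ k (t, x)) volume := fun x =>
    dom1 (K := wgt x + |k|) (C := C) (mA.comp (measurable_id.prodMk measurable_const)) hR
      (add_nonneg (wgt_nonneg x) (abs_nonneg k)) hC0 (fun t ht => zA t x (Or.inr ht))
      (fun t _ => (hA_bound b1 t x).trans
        (mul_le_mul_of_nonneg_right (by linarith [wgt_nonneg t]) hC0))
  have sB : ∀ t, Integrable (fun x => hB φ k (t, x)) volume := fun t =>
    dom1 (mB.comp (measurable_const.prodMk measurable_id)) hR hK hC0
      (fun x hx => zB t x (Or.inl hx)) (fun x hx => hB_bound hC0 b2 b3 t x hx)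
  -- initial term
  have i0 : Integrable (fun x => |uInit x - k| * φ (x, 0)) volume := by
    refine dom1 (K := |k|) (C := C) ?_ hR (abs_nonneg k) hC0 ?_ ?_
    · exact (measurable_abs.comp (measurable_uInit.sub_const k)).mul
        (hφ.continuous.measurable.comp (measurable_id.prodMk measurable_const))
    · intro x hx
      simp [(hz x 0 (Or.inl hx)).1]
    · intro x _
      rw [abs_mul, abs_abs]
      have h1 : |uInit x - k| ≤ wgt x + |k| :=
        (abs_sub _ _).trans (add_le_add_left (abs_uInit_le x) _)
      exact mul_le_mul h1 (b3 _) (abs_nonneg _) (add_nonneg (wgt_nonneg x) (abs_nonneg k))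
  -- the splitting
  have split : (∫ t in Ioi (0 : ℝ), ∫ x : ℝ,
          (|uShock (x, t) - k| * fderiv ℝ φ (x, t) (0, 1)
            + sgn (uShock (x, t) - k) * (x * (uShock (x, t)) ^ 2 - x * k ^ 2)
                * fderiv ℝ φ (x, t) (1, 0)
            - sgn (uShock (x, t) - k) * k ^ 2 * φ (x, t)))
      = (∫ x, ∫ t in Ioi (0:ℝ), hA φ k (t, x)) + ∫ t in Ioi (0:ℝ), ∫ x, hB φ k (t, x) := by
    rw [← integral_prod_symm _ iA, ← integral_prod _ iB, ← integral_add iA iB,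
      integral_prod (fun p => hA φ k p + hB φ k p) (iA.add iB)]
    refine integral_congr_ae (ae_of_all _ fun t => ?_)
    refine integral_congr_ae (ae_of_all _ fun x => ?_)
    simp only [hA, hB]
    ring
  have iAx : Integrable (fun x => ∫ t in Ioi (0:ℝ), hA φ k (t, x)) volume := iA.integral_prod_right
  have eJ : ∀ x, (∫ t in Ioi (0:ℝ), hA φ k (t, x)) + |uInit x - k| * φ (x, 0) = jA φ k x :=
    fun x => A_eval hφ hR hz k x (sA x)
  have iJ : Integrable (jA φ k) volume :=
    (iAx.add i0).congr (ae_of_all _ fun x => eJ x)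
  have sumJ : (∫ x, ∫ t in Ioi (0:ℝ), hA φ k (t, x)) + ∫ x, |uInit x - k| * φ (x, 0)
      = ∫ x, jA φ k x := by
    rw [← integral_add iAx i0]
    exact integral_congr_ae (ae_of_all _ fun x => eJ x)
  -- change of variables
  have himg : (fun t : ℝ => t ^ 2 / 4) '' Ioi 0 = Ioi 0 := by
    ext x
    constructor
    · rintro ⟨t, ht, rfl⟩
      have ht' : 0 < t := ht
      exact mem_Ioi.2 (by positivity)
    · intro hx
      have hx' : 0 < x := hx
      refine ⟨2 * Real.sqrt x, mem_Ioi.2 (by positivity), ?_⟩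
      simp only [mul_pow, Real.sq_sqrt hx'.le]
      ring
  have hder : ∀ t ∈ Ioi (0:ℝ), HasDerivWithinAt (fun t : ℝ => t ^ 2 / 4) (t / 2) (Ioi 0) t := by
    intro t _
    have := ((hasDerivAt_pow 2 t).div_const 4)
    refine (this.congr_deriv ?_).hasDerivWithinAt
    norm_num; ring
  have hinj : InjOn (fun t : ℝ => t ^ 2 / 4) (Ioi 0) := by
    intro a ha b hb hab
    have ha' : 0 < a := ha
    have hb' : 0 < b := hb
    simp only at hab
    have h : a ^ 2 = b ^ 2 := by linarith
    exact (pow_left_inj₀ ha'.le hb'.le two_ne_zero).1 h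
  have cv := integral_image_eq_integral_abs_deriv_smul measurableSet_Ioi hder hinj (jA φ k)
  have icv := (integrableOn_image_iff_integrableOn_abs_deriv_smul measurableSet_Ioi hder hinj
    (jA φ k)).1 iJ.integrableOn
  rw [himg] at cv
  have hJ0 : ∫ x, jA φ k x = ∫ x in Ioi (0:ℝ), jA φ k x := by
    symm
    apply setIntegral_eq_integral_of_forall_compl_eq_zero
    intro x hx
    exact if_neg hx
  rw [split, add_right_comm, sumJ, hJ0, cv, ← integral_add icv iB.integral_prod_left]
  refine setIntegral_nonneg measurableSet_Ioi fun t ht => ?_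
  have ht' : 0 < t := ht
  rw [B_eval hφ hR hz k t ht' (sB t)]
  have hx : (0:ℝ) < t ^ 2 / 4 := by positivity
  have hsq : Real.sqrt (t ^ 2 / 4) = t / 2 := by
    rw [show t ^ 2 / 4 = (t / 2) ^ 2 by ring, Real.sqrt_sq (by positivity)]
  simp only [jA, hx, if_true, hsq, smul_eq_mul]
  rw [abs_of_pos (show 0 < t / 2 by positivity), show 2 * (t / 2) = t by ring,
    show 1 / (t / 2) = 2 / t by field_simp]
  have := mul_nonneg (shock_sign k t ht') (hnn (t ^ 2 / 4, t))
  linarith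

/-- `uShock` is a Kružkov entropy solution of `u_t + (x u²)_x = 0` with
initial datum `uInit`, and `∫ |uShock(·,t) − uInit| = t` for all `t > 0`, so
`uShock(·,t) → uInit` in `L¹(ℝ)` as `t → 0⁺`: a non-stationary entropy solution of the
same Cauchy problem solved by the stationary one. -/
theorem statement9 :
    EntropySol uShock uInit ∧
    (∀ t : ℝ, 0 < t → ∫ x : ℝ, |uShock (x, t) - uInit x| = t) ∧
    Tendsto (fun t => ∫ x : ℝ, |uShock (x, t) - uInit x|)
      (nhdsWithin 0 (Ioi 0)) (nhds 0) := by

  refine ⟨entropy_part, part_two, ?_⟩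
  have h : Tendsto (fun t : ℝ => t) (nhdsWithin 0 (Ioi 0)) (nhds 0) :=
    tendsto_id.mono_left nhdsWithin_le_nhds
  refine h.congr' ?_
  filter_upwards [self_mem_nhdsWithin] with t ht
  exact (part_two t ht).symm
end

section
/- Let T > 0, let u₀ ∈ L¹_loc(ℝ), and let u be a weak solution of u_t + (x u²)_x = 0 on ℝ × (0,T) with initial datum u₀ (so in particular u and (x,t) ↦ x·u(x,t)² are locally integrable). Then the flux x·u² has zero trace at the interface x = 0 in the following averaged sense: for every nonnegative ψ ∈ C_c^∞((−∞,T)), lim_{ε→0⁺} (1/ε) ∫₀^T ∫_{−ε}^{ε} |x|·u(x,t)²·ψ(t) dx dt = 0. -/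
open MeasureTheory Set Filter

/-- `u` is a weak solution of `u_t + (x u²)_x = 0` on `ℝ × (0,T)` with initial datum `u₀`:
`u` and the flux `x u²` are locally integrable on the strip, and the integral identity holds
for every smooth compactly supported test function with support in `ℝ × (−∞,T)`.
Points of `ℝ × ℝ` are written `(x, t)`. -/
def IsWeakSolution (T : ℝ) (u : ℝ × ℝ → ℝ) (u₀ : ℝ → ℝ) : Prop :=
  LocallyIntegrableOn u (univ ×ˢ Ioo 0 T) volume ∧
  LocallyIntegrableOn (fun p => p.1 * (u p) ^ 2) (univ ×ˢ Ioo 0 T) volume ∧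
  ∀ φ : ℝ × ℝ → ℝ, ContDiff ℝ (⊤ : ℕ∞) φ → HasCompactSupport φ →
    tsupport φ ⊆ univ ×ˢ Iio T →
    (∫ t in Ioo (0 : ℝ) T, ∫ x : ℝ,
        (u (x, t) * fderiv ℝ φ (x, t) (0, 1)
          + x * (u (x, t)) ^ 2 * fderiv ℝ φ (x, t) (1, 0)))
      + ∫ x : ℝ, u₀ x * φ (x, 0) = 0

/-- smooth step derivative -/
noncomputable def dS (v : ℝ) : ℝ := deriv Real.smoothTransition v

lemma S_smooth : ContDiff ℝ (⊤ : ℕ∞) Real.smoothTransition := Real.smoothTransition.contDiff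

lemma S_hasDeriv (v : ℝ) : HasDerivAt Real.smoothTransition (dS v) v :=
  ((S_smooth.differentiable (by simp)) v).hasDerivAt

lemma dS_cont : Continuous dS := S_smooth.continuous_deriv (by simp)

lemma S_mono : Monotone Real.smoothTransition := Real.smoothTransition.monotone

lemma dS_nonneg (v : ℝ) : 0 ≤ dS v := S_mono.deriv_nonneg

lemma dS_zero_left {v : ℝ} (h : v < 0) : dS v = 0 := by
  have : Real.smoothTransition =ᶠ[nhds v] fun _ => 0 := by
    filter_upwards [Iio_mem_nhds h] with w hw
    exact Real.smoothTransition.zero_of_nonpos (le_of_lt hw)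
  unfold dS
  rw [this.deriv_eq]; simp

lemma dS_zero_right {v : ℝ} (h : 1 < v) : dS v = 0 := by
  have : Real.smoothTransition =ᶠ[nhds v] fun _ => 1 := by
    filter_upwards [Ioi_mem_nhds h] with w hw
    exact Real.smoothTransition.one_of_one_le (le_of_lt hw)
  unfold dS
  rw [this.deriv_eq]; simp

lemma dS_bdd : ∃ K : ℝ, 0 < K ∧ ∀ v, dS v ≤ K := by
  obtain ⟨M, hM⟩ := (isCompact_Icc (a := (0:ℝ)) (b := 1)).bddAbove_image dS_cont.continuousOn
  refine ⟨max M 1, by positivity, fun v => ?_⟩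
  rcases lt_or_ge v 0 with h | h
  · rw [dS_zero_left h]; positivity
  rcases lt_or_ge 1 v with h' | h'
  · rw [dS_zero_right h']; positivity
  exact le_max_of_le_left (hM ⟨v, ⟨h, h'⟩, rfl⟩)

/-- spatial cutoff -/
noncomputable def th (y : ℝ) : ℝ := Real.smoothTransition (2 - y ^ 2)
/-- derivative of the cutoff -/
noncomputable def dth (y : ℝ) : ℝ := - (2 * y) * dS (2 - y ^ 2)
/-- minus y times the derivative of the cutoff -/
noncomputable def thB (y : ℝ) : ℝ := 2 * y ^ 2 * dS (2 - y ^ 2)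

lemma th_smooth : ContDiff ℝ (⊤ : ℕ∞) th := by
  unfold th
  exact S_smooth.comp (by fun_prop)

lemma th_hasDeriv (y : ℝ) : HasDerivAt th (dth y) y := by
  have h1 : HasDerivAt (fun y : ℝ => 2 - y ^ 2) (-(2 * y)) y := by
    have := ((hasDerivAt_id y).pow 2).const_sub 2
    simpa using this
  have := (S_hasDeriv (2 - y ^ 2)).comp y h1
  unfold dth
  rw [mul_comm]
  exact this

lemma dth_cont : Continuous dth := by
  unfold dth
  exact (by fun_prop : Continuous fun y : ℝ => - (2 * y)).mul (dS_cont.comp (by fun_prop))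

lemma thB_cont : Continuous thB := by
  unfold thB
  exact (by fun_prop : Continuous fun y : ℝ => 2 * y ^ 2).mul (dS_cont.comp (by fun_prop))

lemma thB_eq (y : ℝ) : y * dth y = - thB y := by unfold thB dth; ring

lemma thB_nonneg (y : ℝ) : 0 ≤ thB y := mul_nonneg (by positivity) (dS_nonneg _)
lemma th_nonneg (y : ℝ) : 0 ≤ th y := Real.smoothTransition.nonneg _
lemma th_le_one (y : ℝ) : th y ≤ 1 := Real.smoothTransition.le_one _

lemma sq_big {y : ℝ} (h : 2 < |y|) : 2 - y ^ 2 < 0 := by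
  have : 4 < |y| ^ 2 := by nlinarith
  rw [sq_abs] at this; linarith

lemma th_zero {y : ℝ} (h : 2 < |y|) : th y = 0 :=
  Real.smoothTransition.zero_of_nonpos (sq_big h).le
lemma dth_zero {y : ℝ} (h : 2 < |y|) : dth y = 0 := by
  unfold dth; rw [dS_zero_left (sq_big h)]; simp
lemma thB_zero {y : ℝ} (h : 2 < |y|) : thB y = 0 := by
  unfold thB; rw [dS_zero_left (sq_big h)]; simp

lemma thB_even (y : ℝ) : thB |y| = thB y := by unfold thB; rw [sq_abs]

lemma thB_bdd : ∃ K : ℝ, 0 < K ∧ ∀ v, thB v ≤ K := by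
  obtain ⟨K, hK, h⟩ := dS_bdd
  refine ⟨8 * K, by positivity, fun v => ?_⟩
  rcases lt_or_ge 2 |v| with h' | h'
  · rw [thB_zero h']; positivity
  unfold thB
  have : v ^ 2 ≤ 4 := by rw [← sq_abs]; nlinarith [abs_nonneg v]
  have := h (2 - v ^ 2)
  have := dS_nonneg (2 - v ^ 2)
  nlinarith [sq_nonneg v]

lemma thB_shell : ∃ p q c : ℝ, 0 < p ∧ p < q ∧ 0 < c ∧ ∀ y, p ≤ |y| → |y| ≤ q → c ≤ thB y := by
  obtain ⟨v, hv, hv'⟩ := exists_hasDerivAt_eq_slope Real.smoothTransition dS (zero_lt_one)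
    (S_smooth.continuous.continuousOn) (fun x _ => S_hasDeriv x)
  have hd : dS v = 1 := by
    rw [hv', Real.smoothTransition.one, Real.smoothTransition.zero]; norm_num
  have hy : 0 < √(2 - v) := Real.sqrt_pos.2 (by linarith [hv.2])
  have hB : 0 < thB (√(2 - v)) := by
    unfold thB
    rw [Real.sq_sqrt (by linarith [hv.2])]
    rw [show 2 - (2 - v) = v by ring, hd]
    linarith [hv.2]
  have : ∀ᶠ y in nhds (√(2 - v)), thB (√(2 - v)) / 2 < thB y :=
    thB_cont.continuousAt.eventually (lt_mem_nhds (by linarith))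
  obtain ⟨δ, hδ, h⟩ := Metric.eventually_nhds_iff.1 this
  set y₀ := √(2 - v)
  refine ⟨y₀, y₀ + δ / 2, thB y₀ / 2, hy, by linarith, by linarith, fun y h1 h2 => ?_⟩
  rw [← thB_even y]
  refine (h ?_).le
  rw [Real.dist_eq, abs_of_nonneg (by linarith)]; linarith

/-- the test function -/
noncomputable def tf (α σ : ℝ → ℝ) (p : ℝ × ℝ) : ℝ := α p.2 * th (p.1 / (σ p.2) ^ 2)

lemma tf_smooth {α σ : ℝ → ℝ} (hα : ContDiff ℝ (⊤ : ℕ∞) α) (hσ : ContDiff ℝ (⊤ : ℕ∞) σ)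
    (hpos : ∀ t, 0 < σ t) : ContDiff ℝ (⊤ : ℕ∞) (tf α σ) := by
  unfold tf
  refine (hα.comp contDiff_snd).mul (th_smooth.comp ?_)
  exact contDiff_fst.div ((hσ.comp contDiff_snd).pow 2) (fun p => by have := hpos p.2; simp; positivity)

lemma tf_dx {α σ : ℝ → ℝ} (hα : ContDiff ℝ (⊤ : ℕ∞) α) (hσ : ContDiff ℝ (⊤ : ℕ∞) σ)
    (hpos : ∀ t, 0 < σ t) (x t : ℝ) :
    fderiv ℝ (tf α σ) (x, t) (1, 0) = α t * (dth (x / σ t ^ 2) * (1 / σ t ^ 2)) := by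
  have h1 := ((tf_smooth hα hσ hpos).differentiable (by simp) (x, t)).hasFDerivAt
  have h2 := h1.comp_hasDerivAt x ((hasDerivAt_id x).prodMk (hasDerivAt_const x t))
  have h3 : HasDerivAt (fun x => α t * th (x / σ t ^ 2))
      (α t * (dth (x / σ t ^ 2) * (1 / σ t ^ 2))) x :=
    ((th_hasDeriv _).comp x ((hasDerivAt_id x).div_const _)).const_mul _
  exact h2.unique h3

lemma tf_dt {α σ : ℝ → ℝ} (hα : ContDiff ℝ (⊤ : ℕ∞) α) (hσ : ContDiff ℝ (⊤ : ℕ∞) σ)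
    (hpos : ∀ t, 0 < σ t) (x t : ℝ) :
    fderiv ℝ (tf α σ) (x, t) (0, 1) = deriv α t * th (x / σ t ^ 2) +
      2 * α t * thB (x / σ t ^ 2) * (deriv σ t / σ t) := by
  have h1 := ((tf_smooth hα hσ hpos).differentiable (by simp) (x, t)).hasFDerivAt
  have h2 := h1.comp_hasDerivAt t ((hasDerivAt_const t x).prodMk (hasDerivAt_id t))
  have ha : HasDerivAt α (deriv α t) t := (hα.differentiable (by simp) t).hasDerivAt
  have hs : HasDerivAt σ (deriv σ t) t := (hσ.differentiable (by simp) t).hasDerivAt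
  have hne := (hpos t).ne'
  have h3 := ha.mul ((th_hasDeriv _).comp t
    ((hasDerivAt_const t x).div (hs.pow 2) (pow_ne_zero 2 hne)))
  have h4 := h2.unique h3
  rw [h4]
  simp only [Function.comp, Pi.div_apply, Pi.pow_apply]
  have : thB (x / σ t ^ 2) = - (x / σ t ^ 2 * dth (x / σ t ^ 2)) := by rw [thB_eq]; ring
  rw [this]
  field_simp
  simp
  ring

lemma tf_support {α σ : ℝ → ℝ} {s b M : ℝ} (hpos : ∀ t, 0 < σ t)
    (hα : ∀ t, t ∉ Icc s b → α t = 0) (hM : ∀ t ∈ Icc s b, σ t ^ 2 ≤ M) :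
    Function.support (tf α σ) ⊆ Icc (-(2 * M)) (2 * M) ×ˢ Icc s b := by
  intro p hp
  have h2 : p.2 ∈ Icc s b := by
    by_contra h
    exact hp (by simp [tf, hα _ h])
  have h1 : |p.1 / σ p.2 ^ 2| ≤ 2 := by
    by_contra h
    exact hp (by simp [tf, th_zero (not_le.1 h)])
  have := hM _ h2
  have h3 : 0 < σ p.2 ^ 2 := by have := hpos p.2; positivity
  rw [abs_div, abs_of_pos h3, div_le_iff₀ h3] at h1
  exact ⟨abs_le.1 (by linarith), h2⟩

/-- Lebesgue measure on the strip -/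
noncomputable def str (T : ℝ) : Measure (ℝ × ℝ) :=
  (volume : Measure ℝ).prod (volume.restrict (Ioo 0 T))

lemma str_eq (T : ℝ) : str T = (volume : Measure (ℝ × ℝ)).restrict (univ ×ˢ Ioo 0 T) := by
  rw [Measure.volume_eq_prod, ← Measure.prod_restrict, Measure.restrict_univ, str]

instance str_sfinite (T : ℝ) : SFinite (str T) := by
  unfold str; infer_instance

lemma u_aesm {T : ℝ} {u : ℝ × ℝ → ℝ} {u₀ : ℝ → ℝ} (hu : IsWeakSolution T u u₀) :
    AEStronglyMeasurable u (str T) := by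
  rw [str_eq]; exact hu.1.aestronglyMeasurable

lemma cont_int {T : ℝ} {f : ℝ × ℝ → ℝ} (hf : Continuous f) {K : Set (ℝ × ℝ)} (hK : IsCompact K)
    (h : Function.support f ⊆ K) : Integrable f (str T) := by
  rw [str_eq]
  refine Integrable.restrict ?_
  exact hf.integrable_of_hasCompactSupport (HasCompactSupport.intro hK (fun x hx => by
    by_contra h'; exact hx (h h')))

lemma weakW {T : ℝ} {u : ℝ × ℝ → ℝ} {u₀ : ℝ → ℝ} (hu : IsWeakSolution T u u₀)
    {φ : ℝ × ℝ → ℝ} (h1 : ContDiff ℝ (⊤ : ℕ∞) φ) (h2 : HasCompactSupport φ)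
    (h3 : tsupport φ ⊆ univ ×ˢ Iio T)
    (hI : Integrable (fun p : ℝ × ℝ => u p * fderiv ℝ φ p (0, 1)
          + p.1 * (u p) ^ 2 * fderiv ℝ φ p (1, 0)) (str T)) :
    (∫ p, (u p * fderiv ℝ φ p (0, 1)
          + p.1 * (u p) ^ 2 * fderiv ℝ φ p (1, 0)) ∂(str T)) + ∫ x : ℝ, u₀ x * φ (x, 0) = 0 := by
  have h := hu.2.2 φ h1 h2 h3
  have e := integral_prod_symm (μ := (volume : Measure ℝ)) (ν := volume.restrict (Ioo 0 T)) _ hI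
  rw [← e] at h
  exact h

lemma integral_thB_nonneg : 0 ≤ ∫ y, thB y := integral_nonneg thB_nonneg

lemma deriv_zero_out {α : ℝ → ℝ} {s b : ℝ} (hα : ∀ t, t ∉ Icc s b → α t = 0) (t : ℝ)
    (ht : t ∉ Icc s b) : deriv α t = 0 := by
  have : α =ᶠ[nhds t] fun _ => 0 := by
    filter_upwards [isClosed_Icc.isOpen_compl.mem_nhds ht] with w hw
    exact hα w hw
  rw [this.deriv_eq]; simp

lemma mainL {T : ℝ} {u : ℝ × ℝ → ℝ} {u₀ : ℝ → ℝ} (hu : IsWeakSolution T u u₀)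
    {α σ : ℝ → ℝ} (hα : ContDiff ℝ (⊤ : ℕ∞) α) (hσ : ContDiff ℝ (⊤ : ℕ∞) σ)
    (hpos : ∀ t, 0 < σ t) (hα0 : ∀ t, 0 ≤ α t) (hα1 : ∀ t, α t ≤ 1) {s b : ℝ} (hb : b < T)
    (hsupp : ∀ t, t ∉ Icc s b → α t = 0)
    (hI1 : Integrable (fun p : ℝ × ℝ => u p * (deriv α p.2 * th (p.1 / σ p.2 ^ 2))) (str T))
    (hI2 : Integrable (fun p : ℝ × ℝ => α p.2 * (u p) ^ 2 * thB (p.1 / σ p.2 ^ 2)) (str T)) :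
    (1 / 2) * ∫ p, α p.2 * (u p) ^ 2 * thB (p.1 / σ p.2 ^ 2) ∂(str T) ≤
      (∫ p, u p * (deriv α p.2 * th (p.1 / σ p.2 ^ 2)) ∂(str T))
      + 2 * (∫ y, thB y) * (∫ t in Ioo 0 T, (deriv σ t) ^ 2)
      + α 0 * ∫ x, u₀ x * th (x / σ 0 ^ 2) := by
  obtain ⟨M, hM⟩ := (isCompact_Icc (a := s) (b := b)).bddAbove_image
    (hσ.continuous.pow 2).continuousOn
  have hM' : ∀ t ∈ Icc s b, σ t ^ 2 ≤ M := fun t ht => hM ⟨t, ht, rfl⟩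
  have hK : IsCompact (Icc (-(2 * M)) (2 * M) ×ˢ Icc s b) := isCompact_Icc.prod isCompact_Icc
  have hsub := tf_support hpos hsupp hM'
  have hdσ : Continuous (deriv σ) := hσ.continuous_deriv (by simp)
  have hdα : Continuous (deriv α) := hα.continuous_deriv (by simp)
  have hσc := hσ.continuous
  have hαc := hα.continuous
  have hyc : Continuous (fun p : ℝ × ℝ => p.1 / σ p.2 ^ 2) :=
    continuous_fst.div ((hσc.comp continuous_snd).pow 2)
      (fun p => pow_ne_zero 2 (hpos p.2).ne')
  have hqc : Continuous (fun p : ℝ × ℝ => deriv σ p.2 / σ p.2) :=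
    (hdσ.comp continuous_snd).div (hσc.comp continuous_snd) (fun p => (hpos p.2).ne')
  set J : ℝ × ℝ → ℝ := fun p => α p.2 * thB (p.1 / σ p.2 ^ 2) * (deriv σ p.2 / σ p.2) ^ 2 with hJ
  have hJc : Continuous J :=
    ((hαc.comp continuous_snd).mul (thB_cont.comp hyc)).mul (hqc.pow 2)
  have hJs : Function.support J ⊆ Icc (-(2 * M)) (2 * M) ×ˢ Icc s b := by
    intro p hp
    have h2 : p.2 ∈ Icc s b := by
      by_contra h
      exact hp (by simp [hJ, hsupp _ h])
    have h1 : |p.1 / σ p.2 ^ 2| ≤ 2 := by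
      by_contra h
      exact hp (by simp [hJ, thB_zero (not_le.1 h)])
    have := hM' _ h2
    have h3 : 0 < σ p.2 ^ 2 := by have := hpos p.2; positivity
    rw [abs_div, abs_of_pos h3, div_le_iff₀ h3] at h1
    exact ⟨abs_le.1 (by linarith), h2⟩
  have hJi : Integrable J (str T) := cont_int hJc hK hJs
  have hJint : ∫ p, J p ∂(str T) ≤ (∫ y, thB y) * (∫ t in Ioo 0 T, (deriv σ t) ^ 2) := by
    have e : ∫ p, J p ∂(str T) = ∫ t in Ioo 0 T, ∫ x, J (x, t) := integral_prod_symm _ hJi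
    rw [e, ← integral_const_mul]
    refine integral_mono_of_nonneg ?_ ?_ ?_
    · refine Eventually.of_forall fun t => integral_nonneg fun x => ?_
      exact mul_nonneg (mul_nonneg (hα0 _) (thB_nonneg _)) (sq_nonneg _)
    · exact (((continuous_const.mul (hdσ.pow 2)).integrableOn_Icc (a := 0) (b := T)).mono_set
        Ioo_subset_Icc_self)
    · refine Eventually.of_forall fun t => ?_
      have h3 : 0 < σ t ^ 2 := by have := hpos t; positivity
      have : ∫ x, J (x, t) = α t * ((∫ y, thB y) * deriv σ t ^ 2) := by
        simp only [hJ]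
        rw [integral_mul_const, integral_const_mul, Measure.integral_comp_div thB (σ t ^ 2),
          abs_of_pos h3, smul_eq_mul]
        have := (hpos t).ne'
        field_simp
      show ∫ x, J (x, t) ≤ (∫ y, thB y) * deriv σ t ^ 2
      rw [this]
      exact mul_le_of_le_one_left (mul_nonneg integral_thB_nonneg (sq_nonneg _)) (hα1 t)
  -- the cross term
  set X : ℝ × ℝ → ℝ := fun p => u p * (2 * α p.2 * thB (p.1 / σ p.2 ^ 2) * (deriv σ p.2 / σ p.2))
    with hX
  have hXi : Integrable X (str T) := by
    refine (hI2.add hJi).mono ((u_aesm hu).mul ?_) (Eventually.of_forall fun p => ?_)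
    · exact (((continuous_const.mul (hαc.comp continuous_snd)).mul
        (thB_cont.comp hyc)).mul hqc).aestronglyMeasurable
    · have hw : 0 ≤ α p.2 * thB (p.1 / σ p.2 ^ 2) := mul_nonneg (hα0 _) (thB_nonneg _)
      have e : (fun p : ℝ × ℝ => α p.2 * (u p) ^ 2 * thB (p.1 / σ p.2 ^ 2)) p + J p =
          α p.2 * thB (p.1 / σ p.2 ^ 2) * ((u p) ^ 2 + (deriv σ p.2 / σ p.2) ^ 2) := by
        simp only [hJ]; ring
      have e2 : X p = α p.2 * thB (p.1 / σ p.2 ^ 2) * (2 * u p * (deriv σ p.2 / σ p.2)) := by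
        simp only [hX]; ring
      rw [Pi.add_apply, e, e2, Real.norm_eq_abs, Real.norm_eq_abs, abs_mul _ (2 * u p * _),
        abs_mul _ ((u p) ^ 2 + _),
        abs_of_nonneg (by positivity : 0 ≤ (u p) ^ 2 + (deriv σ p.2 / σ p.2) ^ 2)]
      refine mul_le_mul_of_nonneg_left ?_ (abs_nonneg _)
      rw [abs_le]
      constructor <;> nlinarith [sq_nonneg (u p + deriv σ p.2 / σ p.2),
        sq_nonneg (u p - deriv σ p.2 / σ p.2)]
  -- weak identity
  have hG : (fun p : ℝ × ℝ => u p * fderiv ℝ (tf α σ) p (0, 1)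
          + p.1 * (u p) ^ 2 * fderiv ℝ (tf α σ) p (1, 0)) =
      fun p => u p * (deriv α p.2 * th (p.1 / σ p.2 ^ 2)) + X p -
        α p.2 * (u p) ^ 2 * thB (p.1 / σ p.2 ^ 2) := by
    funext p
    obtain ⟨x, t⟩ := p
    rw [tf_dx hα hσ hpos, tf_dt hα hσ hpos]
    have : thB (x / σ t ^ 2) = - (x / σ t ^ 2 * dth (x / σ t ^ 2)) := by rw [thB_eq]; ring
    simp only [hX, this]
    ring
  have hW := weakW hu (tf_smooth hα hσ hpos)
    (HasCompactSupport.intro hK (fun x hx => by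
      by_contra h'; exact hx (hsub h')))
    ((closure_minimal hsub hK.isClosed).trans (prod_mono (subset_univ _)
      (fun t ht => lt_of_le_of_lt ht.2 hb)))
    (by rw [hG]; exact (hI1.add hXi).sub hI2)
  have e1 : ∫ p, (u p * (deriv α p.2 * th (p.1 / σ p.2 ^ 2)) + X p -
        α p.2 * (u p) ^ 2 * thB (p.1 / σ p.2 ^ 2)) ∂(str T) =
      (∫ p, u p * (deriv α p.2 * th (p.1 / σ p.2 ^ 2)) ∂(str T)) + (∫ p, X p ∂(str T)) -
      ∫ p, α p.2 * (u p) ^ 2 * thB (p.1 / σ p.2 ^ 2) ∂(str T) := by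
    rw [← integral_add hI1 hXi]
    exact integral_sub (hI1.add hXi) hI2
  rw [hG, e1] at hW
  have e2 : ∫ x, u₀ x * tf α σ (x, 0) = α 0 * ∫ x, u₀ x * th (x / σ 0 ^ 2) := by
    rw [← integral_const_mul]
    congr 1
    funext x
    simp only [tf]; ring
  rw [e2] at hW
  have hXle : ∫ p, X p ∂(str T) ≤
      (1 / 2) * (∫ p, α p.2 * (u p) ^ 2 * thB (p.1 / σ p.2 ^ 2) ∂(str T)) +
      2 * ∫ p, J p ∂(str T) := by
    rw [← integral_const_mul, ← integral_const_mul,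
      ← integral_add (hI2.const_mul _) (hJi.const_mul _)]
    refine integral_mono hXi ((hI2.const_mul _).add (hJi.const_mul _)) fun p => ?_
    have hw : 0 ≤ α p.2 * thB (p.1 / σ p.2 ^ 2) := mul_nonneg (hα0 _) (thB_nonneg _)
    simp only [hX, hJ]
    nlinarith [mul_nonneg hw (sq_nonneg (u p - 2 * (deriv σ p.2 / σ p.2)))]
  linarith

lemma box_int {T : ℝ} {g : ℝ × ℝ → ℝ} (hg : LocallyIntegrableOn g (univ ×ˢ Ioo 0 T) volume)
    {s b : ℝ} (hs : 0 < s) (hb : b < T) (M : ℝ) :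
    IntegrableOn g (Icc (-M) M ×ˢ Icc s b) volume :=
  hg.integrableOn_compact_subset (prod_mono (subset_univ _)
    (fun t ht => ⟨lt_of_lt_of_le hs ht.1, lt_of_le_of_lt ht.2 hb⟩))
    (isCompact_Icc.prod isCompact_Icc)

lemma loc_int {T : ℝ} {g : ℝ × ℝ → ℝ} (hg : LocallyIntegrableOn g (univ ×ˢ Ioo 0 T) volume)
    {s b : ℝ} (hs : 0 < s) (hb : b < T) {M : ℝ} {w : ℝ × ℝ → ℝ} (hw : Continuous w)
    (hsupp : ∀ p, w p ≠ 0 → p ∈ Icc (-M) M ×ˢ Icc s b) :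
    Integrable (fun p => g p * w p) (str T) := by
  rw [str_eq]
  refine Integrable.restrict ?_
  have hK : IsCompact (Icc (-M) M ×ˢ Icc s b) := isCompact_Icc.prod isCompact_Icc
  have := (box_int hg hs hb M).mul_continuousOn hw.continuousOn hK
  rw [integrableOn_iff_integrable_of_support_subset] at this
  · exact this
  · intro p hp
    exact hsupp p (right_ne_zero_of_mul hp)

/-- local `L¹` mass of `u` in a thin box -/
noncomputable def Nu (T : ℝ) (u : ℝ × ℝ → ℝ) (s b ρ : ℝ) : ℝ :=
  ∫ p, (Icc (-ρ) ρ ×ˢ Icc s b).indicator (fun p => |u p|) p ∂(str T)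

lemma meas_box (ρ s b : ℝ) : MeasurableSet (Icc (-ρ) ρ ×ˢ Icc s b : Set (ℝ × ℝ)) :=
  measurableSet_Icc.prod measurableSet_Icc

lemma ind_int {T : ℝ} {u : ℝ × ℝ → ℝ} {u₀ : ℝ → ℝ} (hu : IsWeakSolution T u u₀)
    {s b : ℝ} (hs : 0 < s) (hb : b < T) (ρ : ℝ) :
    Integrable ((Icc (-ρ) ρ ×ˢ Icc s b).indicator (fun p => |u p|)) (str T) := by
  rw [str_eq]
  refine Integrable.restrict ?_
  rw [integrable_indicator_iff (meas_box _ _ _)]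
  exact (box_int hu.1 hs hb ρ).abs

lemma ae_ne (T : ℝ) : ∀ᵐ p ∂(str T), p.1 ≠ 0 := by
  have h : (str T) ({(0:ℝ)} ×ˢ (univ : Set ℝ)) = 0 := by
    rw [str, Measure.prod_prod]; simp
  rw [ae_iff]
  refine measure_mono_null ?_ h
  intro p hp
  simpa using hp

lemma Nu_nonneg (T : ℝ) (u : ℝ × ℝ → ℝ) (s b ρ : ℝ) : 0 ≤ Nu T u s b ρ :=
  integral_nonneg fun p => indicator_nonneg (fun _ _ => abs_nonneg _) p

lemma Nu_tendsto {T : ℝ} {u : ℝ × ℝ → ℝ} {u₀ : ℝ → ℝ} (hu : IsWeakSolution T u u₀)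
    {s b : ℝ} (hs : 0 < s) (hb : b < T) :
    Tendsto (fun ρ => Nu T u s b ρ) (nhdsWithin 0 (Ioi 0)) (nhds 0) := by
  unfold Nu
  suffices h : Tendsto (fun ρ => ∫ p, (Icc (-ρ) ρ ×ˢ Icc s b).indicator (fun p => |u p|) p ∂(str T))
      (nhdsWithin 0 (Ioi 0)) (nhds (∫ _p, (0 : ℝ) ∂(str T))) by
    rwa [integral_zero] at h
  refine tendsto_integral_filter_of_dominated_convergence
    ((Icc (-1) 1 ×ˢ Icc s b).indicator (fun p => |u p|)) ?_ ?_ (ind_int hu hs hb 1) ?_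
  · exact Eventually.of_forall fun ρ => (ind_int hu hs hb ρ).aestronglyMeasurable
  · filter_upwards [Ioo_mem_nhdsGT (zero_lt_one' ℝ)] with ρ hρ
    refine Eventually.of_forall fun p => ?_
    rw [Real.norm_eq_abs, abs_of_nonneg (indicator_nonneg (fun _ _ => abs_nonneg _) p)]
    refine indicator_le_indicator_of_subset ?_ (fun _ => abs_nonneg _) p
    exact prod_mono (Icc_subset_Icc (by linarith [hρ.2]) hρ.2.le) subset_rfl
  · filter_upwards [ae_ne T] with p hp
    refine tendsto_const_nhds.congr' ?_
    filter_upwards [Ioo_mem_nhdsGT (abs_pos.2 hp)] with ρ hρ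
    rw [indicator_of_notMem]
    rintro ⟨h1, -⟩
    exact absurd (abs_le.2 h1) (not_le.2 hρ.2)

lemma u0_tendsto {u₀ : ℝ → ℝ} (hu₀ : LocallyIntegrable u₀) :
    Tendsto (fun ρ : ℝ => ∫ x, u₀ x * th (x / ρ)) (nhdsWithin 0 (Ioi 0)) (nhds 0) := by
  suffices h : Tendsto (fun ρ : ℝ => ∫ x, u₀ x * th (x / ρ))
      (nhdsWithin 0 (Ioi 0)) (nhds (∫ _p : ℝ, (0 : ℝ))) by
    rwa [integral_zero] at h
  have hI : Integrable ((Icc (-2) 2).indicator (fun x => |u₀ x|)) := by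
    rw [integrable_indicator_iff measurableSet_Icc]
    exact (hu₀.integrableOn_isCompact isCompact_Icc).abs
  refine tendsto_integral_filter_of_dominated_convergence
    ((Icc (-2) 2).indicator (fun x => |u₀ x|)) ?_ ?_ hI ?_
  · exact Eventually.of_forall fun ρ => hu₀.aestronglyMeasurable.mul
      (th_smooth.continuous.comp (continuous_id.div_const ρ)).aestronglyMeasurable
  · filter_upwards [Ioo_mem_nhdsGT (zero_lt_one' ℝ)] with ρ hρ
    refine Eventually.of_forall fun x => ?_
    rw [Real.norm_eq_abs, abs_mul, abs_of_nonneg (th_nonneg _)]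
    by_cases hx : x ∈ Icc (-2 : ℝ) 2
    · rw [indicator_of_mem hx]
      exact mul_le_of_le_one_right (abs_nonneg _) (th_le_one _)
    · rw [indicator_of_notMem hx, th_zero, mul_zero]
      have : 2 < |x| := by
        by_contra h; exact hx (abs_le.1 (not_lt.1 h))
      rw [abs_div, abs_of_pos hρ.1, lt_div_iff₀ hρ.1]
      nlinarith [hρ.1, hρ.2]
  · have : ∀ᵐ x : ℝ, x ≠ 0 := by
      rw [ae_iff]; simp
    filter_upwards [this] with x hx
    refine tendsto_const_nhds.congr' ?_
    have hx' : 0 < |x| / 2 := by have := abs_pos.2 hx; positivity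
    filter_upwards [Ioo_mem_nhdsGT hx'] with ρ hρ
    rw [th_zero, mul_zero]
    rw [abs_div, abs_of_pos hρ.1, lt_div_iff₀ hρ.1]
    linarith [hρ.2]

/-- final cutoff in time -/
noncomputable def ct (a b t : ℝ) : ℝ := Real.smoothTransition ((b - t) / (b - a))

lemma ct_smooth (a b : ℝ) : ContDiff ℝ (⊤ : ℕ∞) (ct a b) := by
  unfold ct
  exact S_smooth.comp (by fun_prop)
lemma ct_nonneg (a b t : ℝ) : 0 ≤ ct a b t := Real.smoothTransition.nonneg _
lemma ct_le_one (a b t : ℝ) : ct a b t ≤ 1 := Real.smoothTransition.le_one _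
lemma ct_one {a b t : ℝ} (hab : a < b) (h : t ≤ a) : ct a b t = 1 :=
  Real.smoothTransition.one_of_one_le (by rw [le_div_iff₀ (by linarith)]; linarith)
lemma ct_zero {a b t : ℝ} (hab : a < b) (h : b ≤ t) : ct a b t = 0 :=
  Real.smoothTransition.zero_of_nonpos (div_nonpos_of_nonpos_of_nonneg (by linarith) (by linarith))

lemma ct_deriv (a b t : ℝ) : deriv (ct a b) t = dS ((b - t) / (b - a)) * (-1 / (b - a)) := by
  have h1 : HasDerivAt (fun t : ℝ => (b - t) / (b - a)) (-1 / (b - a)) t :=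
    ((hasDerivAt_id t).const_sub b).div_const _
  exact ((S_hasDeriv _).comp t h1).deriv

lemma ct_deriv_bdd {a b : ℝ} (hab : a < b) : ∃ K : ℝ, 0 < K ∧ ∀ t, |deriv (ct a b) t| ≤ K := by
  obtain ⟨K, hK, h⟩ := dS_bdd
  have hab' : 0 < b - a := by linarith
  refine ⟨K * (1 / (b - a)), by positivity, fun t => ?_⟩
  rw [ct_deriv, abs_mul, abs_of_nonneg (dS_nonneg _), abs_div, abs_neg, abs_one, abs_of_pos hab']
  exact mul_le_mul_of_nonneg_right (h _) (by positivity)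

lemma caseE_fixed {T : ℝ} {u : ℝ × ℝ → ℝ} {u₀ : ℝ → ℝ} (hu : IsWeakSolution T u u₀)
    {a b : ℝ} (hab : a < b) (hb : b < T) {K KS : ℝ}
    (hKd : ∀ t, |deriv (ct a b) t| ≤ K) (hKS : ∀ v, dS v ≤ KS)
    {t₀ : ℝ} (ht₀ : 0 < t₀) (hta : t₀ < a) :
    ∃ K' : ℝ, ∀ η l : ℝ, 0 < l → l < η →
    ∫⁻ p, (univ ×ˢ Ioo t₀ a).indicator
      (fun p : ℝ × ℝ => ENNReal.ofReal ((u p) ^ 2 * thB (p.1 / η ^ 2))) p ∂(str T) ≤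
    ENNReal.ofReal (2 * (K' * Nu T u (t₀ / 4) (t₀ / 2) (2 * l ^ 2) +
      K * Nu T u a b (2 * η ^ 2) + 2 * (∫ y, thB y) * (2 * KS ^ 2 * (η ^ 2 / t₀)))) := by
  set α : ℝ → ℝ := fun t => Real.smoothTransition (4 * t / t₀ - 1) * ct a b t with hα
  have hαs : ContDiff ℝ (⊤ : ℕ∞) α := (S_smooth.comp (by fun_prop)).mul (ct_smooth a b)
  have hdα : Continuous (deriv α) := hαs.continuous_deriv (by simp)
  have hα0 : ∀ t, 0 ≤ α t := fun t => mul_nonneg (Real.smoothTransition.nonneg _) (ct_nonneg _ _ _)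
  have hα1 : ∀ t, α t ≤ 1 := fun t =>
    mul_le_one₀ (Real.smoothTransition.le_one _) (ct_nonneg _ _ _) (ct_le_one _ _ _)
  have hsupp : ∀ t, t ∉ Icc (t₀ / 4) b → α t = 0 := by
    intro t ht
    rw [mem_Icc, not_and_or, not_le, not_le] at ht
    rcases ht with h | h
    · simp only [hα]
      rw [Real.smoothTransition.zero_of_nonpos, zero_mul]
      rw [sub_nonpos, div_le_one ht₀]; linarith
    · simp only [hα]; rw [ct_zero hab h.le, mul_zero]
  have hct : ∀ t, t₀ / 2 ≤ t → α t = ct a b t := by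
    intro t ht
    simp only [hα]
    rw [Real.smoothTransition.one_of_one_le, one_mul]
    rw [le_sub_iff_add_le, le_div_iff₀ ht₀]; linarith
  have hd1 : ∀ t, t₀ / 2 < t → deriv α t = deriv (ct a b) t := by
    intro t ht
    refine Filter.EventuallyEq.deriv_eq ?_
    filter_upwards [Ioi_mem_nhds ht] with w hw using hct w (le_of_lt hw)
  have hd2 : ∀ t, t < a → deriv (ct a b) t = 0 := by
    intro t ht
    have : ct a b =ᶠ[nhds t] fun _ => 1 := by
      filter_upwards [Iio_mem_nhds ht] with w hw using ct_one hab (le_of_lt hw)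
    rw [this.deriv_eq]; simp
  obtain ⟨K', hK'⟩ := (isCompact_Icc (a := t₀ / 4) (b := t₀ / 2)).bddAbove_image
    hdα.abs.continuousOn
  have hK'' : ∀ t ∈ Icc (t₀ / 4) (t₀ / 2), |deriv α t| ≤ K' := fun t ht => hK' ⟨t, ht, rfl⟩
  refine ⟨K', fun η l hl hη => ?_⟩
  have hη0 : 0 < η := hl.trans hη
  set σ : ℝ → ℝ := fun t => l + (η - l) * Real.smoothTransition (2 * t / t₀ - 1) with hσ
  have hσs : ContDiff ℝ (⊤ : ℕ∞) σ :=
    contDiff_const.add (contDiff_const.mul (S_smooth.comp (by fun_prop)))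
  have hpos : ∀ t, 0 < σ t := fun t =>
    add_pos_of_pos_of_nonneg hl (mul_nonneg (by linarith) (Real.smoothTransition.nonneg _))
  have hσle : ∀ t, σ t ≤ η := fun t => by
    have := Real.smoothTransition.le_one (2 * t / t₀ - 1)
    simp only [hσ]; nlinarith
  have hσl : ∀ t, t ≤ t₀ / 2 → σ t = l := fun t ht => by
    simp only [hσ]
    rw [Real.smoothTransition.zero_of_nonpos]
    · ring
    · rw [sub_nonpos, div_le_one ht₀]; linarith
  have hση : ∀ t, t₀ ≤ t → σ t = η := fun t ht => by
    simp only [hσ]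
    rw [Real.smoothTransition.one_of_one_le]
    · ring
    · rw [le_sub_iff_add_le, le_div_iff₀ ht₀]; linarith
  have hyc : Continuous (fun p : ℝ × ℝ => p.1 / σ p.2 ^ 2) :=
    continuous_fst.div ((hσs.continuous.comp continuous_snd).pow 2)
      (fun p => pow_ne_zero 2 (hpos p.2).ne')
  have hxle : ∀ p : ℝ × ℝ, |p.1 / σ p.2 ^ 2| ≤ 2 → |p.1| ≤ 2 * σ p.2 ^ 2 := by
    intro p h1
    have h3 : 0 < σ p.2 ^ 2 := by have := hpos p.2; positivity
    rwa [abs_div, abs_of_pos h3, div_le_iff₀ h3] at h1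
  have hxle' : ∀ p : ℝ × ℝ, |p.1 / σ p.2 ^ 2| ≤ 2 → p.1 ∈ Icc (-(2 * η ^ 2)) (2 * η ^ 2) := by
    intro p h1
    have h2 := hxle p h1
    have : σ p.2 ^ 2 ≤ η ^ 2 := by
      have := hpos p.2
      have := hσle p.2
      gcongr
    exact abs_le.1 (by linarith)
  have hI1 : Integrable (fun p : ℝ × ℝ => u p * (deriv α p.2 * th (p.1 / σ p.2 ^ 2))) (str T) := by
    refine loc_int hu.1 (s := t₀ / 4) (by positivity) hb (M := 2 * η ^ 2)
      ((hdα.comp continuous_snd).mul (th_smooth.continuous.comp hyc)) ?_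
    intro p hp
    refine ⟨hxle' p ?_, ?_⟩
    · by_contra h
      exact hp (by simp [th_zero (not_le.1 h)])
    · by_contra h
      exact hp (by simp [deriv_zero_out hsupp _ h])
  have hI2 : Integrable (fun p : ℝ × ℝ => α p.2 * (u p) ^ 2 * thB (p.1 / σ p.2 ^ 2)) (str T) := by
    have hc : Continuous (fun p : ℝ × ℝ =>
        - (α p.2 * dth (p.1 / σ p.2 ^ 2) / σ p.2 ^ 2)) :=
      (((hαs.continuous.comp continuous_snd).mul (dth_cont.comp hyc)).div
        ((hσs.continuous.comp continuous_snd).pow 2)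
        (fun p => pow_ne_zero 2 (hpos p.2).ne')).neg
    have := loc_int hu.2.1 (s := t₀ / 4) (by positivity) hb (M := 2 * η ^ 2) hc (by
      intro p hp
      refine ⟨hxle' p ?_, ?_⟩
      · by_contra h
        exact hp (by simp [dth_zero (not_le.1 h)])
      · by_contra h
        exact hp (by simp [hsupp _ h]))
    refine this.congr (Eventually.of_forall fun p => ?_)
    have e : thB (p.1 / σ p.2 ^ 2) = - (p.1 / σ p.2 ^ 2 * dth (p.1 / σ p.2 ^ 2)) := by
      rw [thB_eq]; ring
    simp only [e]
    ring
  have hL := mainL hu hαs hσs hpos hα0 hα1 hb hsupp hI1 hI2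
  rw [hsupp 0 (fun h => by have := h.1; linarith), zero_mul, add_zero] at hL
  -- the derivative of σ
  have hσd : ∀ t, deriv σ t = (η - l) * (dS (2 * t / t₀ - 1) * (2 / t₀)) := by
    intro t
    have h1 : HasDerivAt (fun t : ℝ => 2 * t / t₀ - 1) (2 / t₀) t := by
      have := (((hasDerivAt_id t).const_mul 2).div_const t₀).sub_const 1
      simpa using this
    exact ((((S_hasDeriv _).comp t h1).const_mul (η - l)).const_add l).deriv
  have hKS0 : 0 ≤ KS := (dS_nonneg 0).trans (hKS 0)
  have hσint : ∫ t in Ioo 0 T, (deriv σ t) ^ 2 ≤ 2 * KS ^ 2 * (η ^ 2 / t₀) := by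
    have hle : ∀ t, (deriv σ t) ^ 2 ≤
        (Icc (t₀ / 2) t₀).indicator (fun _ => (η * (KS * (2 / t₀))) ^ 2) t := by
      intro t
      rw [hσd]
      by_cases ht : t ∈ Icc (t₀ / 2) t₀
      · rw [indicator_of_mem ht]
        have h1 := dS_nonneg (2 * t / t₀ - 1)
        have h2 := hKS (2 * t / t₀ - 1)
        have h3 : 0 ≤ η - l := by linarith
        have h4 : η - l ≤ η := by linarith
        gcongr
      · rw [indicator_of_notMem ht]
        rw [mem_Icc, not_and_or, not_le, not_le] at ht
        rcases ht with h | h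
        · rw [dS_zero_left]
          · simp
          · rw [sub_neg, div_lt_one ht₀]; linarith
        · rw [dS_zero_right]
          · simp
          · rw [lt_sub_iff_add_lt, lt_div_iff₀ ht₀]; linarith
    have hind : Integrable ((Icc (t₀ / 2) t₀).indicator
        (fun _ : ℝ => (η * (KS * (2 / t₀))) ^ 2)) := by
      rw [integrable_indicator_iff measurableSet_Icc]
      exact integrableOn_const (by simp)
    calc ∫ t in Ioo 0 T, (deriv σ t) ^ 2
        ≤ ∫ t in Ioo 0 T, (Icc (t₀ / 2) t₀).indicator (fun _ => (η * (KS * (2 / t₀))) ^ 2) t :=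
          integral_mono_of_nonneg (Eventually.of_forall fun t => sq_nonneg _) hind.restrict
            (Eventually.of_forall hle)
      _ ≤ ∫ t, (Icc (t₀ / 2) t₀).indicator (fun _ => (η * (KS * (2 / t₀))) ^ 2) t :=
          setIntegral_le_integral hind (Eventually.of_forall fun t =>
            indicator_nonneg (fun _ _ => sq_nonneg _) t)
      _ = 2 * KS ^ 2 * (η ^ 2 / t₀) := by
          rw [integral_indicator measurableSet_Icc, setIntegral_const, smul_eq_mul,
            Real.volume_real_Icc_of_le (by linarith)]
          field_simp
          ring
  have hIle : ∫ p, u p * (deriv α p.2 * th (p.1 / σ p.2 ^ 2)) ∂(str T) ≤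
      K' * Nu T u (t₀ / 4) (t₀ / 2) (2 * l ^ 2) + K * Nu T u a b (2 * η ^ 2) := by
    have i1 := ind_int hu (s := t₀ / 4) (b := t₀ / 2) (by positivity) (by linarith) (2 * l ^ 2)
    have i2 := ind_int hu (s := a) (b := b) (by linarith) hb (2 * η ^ 2)
    unfold Nu
    rw [← integral_const_mul, ← integral_const_mul,
      ← integral_add (i1.const_mul _) (i2.const_mul _)]
    refine integral_mono hI1 ((i1.const_mul _).add (i2.const_mul _)) fun p => ?_
    have hK0 : 0 ≤ K := (abs_nonneg _).trans (hKd 0)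
    have hK'0 : 0 ≤ K' := (abs_nonneg _).trans (hK'' (t₀ / 2) ⟨by linarith, le_rfl⟩)
    have n1 : 0 ≤ K' * (Icc (-(2 * l ^ 2)) (2 * l ^ 2) ×ˢ Icc (t₀ / 4) (t₀ / 2)).indicator
        (fun p => |u p|) p := mul_nonneg hK'0 (indicator_nonneg (fun _ _ => abs_nonneg _) _)
    have n2 : 0 ≤ K * (Icc (-(2 * η ^ 2)) (2 * η ^ 2) ×ˢ Icc a b).indicator
        (fun p => |u p|) p := mul_nonneg hK0 (indicator_nonneg (fun _ _ => abs_nonneg _) _)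
    show u p * (deriv α p.2 * th (p.1 / σ p.2 ^ 2)) ≤
      K' * (Icc (-(2 * l ^ 2)) (2 * l ^ 2) ×ˢ Icc (t₀ / 4) (t₀ / 2)).indicator
        (fun p => |u p|) p + K * (Icc (-(2 * η ^ 2)) (2 * η ^ 2) ×ˢ Icc a b).indicator
        (fun p => |u p|) p
    by_cases hy : |p.1 / σ p.2 ^ 2| ≤ 2
    swap
    · rw [th_zero (not_le.1 hy)]; simp only [mul_zero]; linarith
    have habs : ∀ k, |deriv α p.2| ≤ k → u p * (deriv α p.2 * th (p.1 / σ p.2 ^ 2)) ≤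
        k * |u p| := by
      intro k hk
      refine (le_abs_self _).trans ?_
      rw [abs_mul, abs_mul, abs_of_nonneg (th_nonneg _), mul_comm]
      refine mul_le_mul_of_nonneg_right ?_ (abs_nonneg _)
      exact (mul_le_of_le_one_right (abs_nonneg _) (th_le_one _)).trans hk
    have hz : deriv α p.2 = 0 → u p * (deriv α p.2 * th (p.1 / σ p.2 ^ 2)) ≤ 0 := by
      intro h; rw [h]; simp
    rcases lt_or_ge p.2 (t₀ / 4) with h | h
    · have := hz (deriv_zero_out hsupp _ (fun h' => by have := h'.1; linarith))
      linarith
    rcases le_or_gt p.2 (t₀ / 2) with h' | h'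
    · have hm : p ∈ Icc (-(2 * l ^ 2)) (2 * l ^ 2) ×ˢ Icc (t₀ / 4) (t₀ / 2) := by
        refine ⟨?_, h, h'⟩
        have := hxle p hy
        rw [hσl _ h'] at this
        exact abs_le.1 this
      rw [indicator_of_mem hm]
      have := habs K' (hK'' _ ⟨h, h'⟩)
      linarith
    rcases lt_or_ge p.2 a with h2 | h2
    · have := hz ((hd1 _ h').trans (hd2 _ h2))
      linarith
    rcases le_or_gt p.2 b with h3 | h3
    · have hm : p ∈ Icc (-(2 * η ^ 2)) (2 * η ^ 2) ×ˢ Icc a b := ⟨hxle' p hy, h2, h3⟩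
      rw [indicator_of_mem hm]
      have := habs K (by rw [hd1 _ h']; exact hKd _)
      linarith
    · have := hz (deriv_zero_out hsupp _ (fun h' => by have := h'.2; linarith))
      linarith
  calc _ ≤ ∫⁻ p, ENNReal.ofReal (α p.2 * (u p) ^ 2 * thB (p.1 / σ p.2 ^ 2)) ∂(str T) := by
        refine lintegral_mono fun p => ?_
        by_cases hp : p ∈ (univ ×ˢ Ioo t₀ a : Set (ℝ × ℝ))
        swap
        · rw [indicator_of_notMem hp]; exact zero_le
        rw [indicator_of_mem hp]
        have h2 := hp.2
        rw [hct _ (by linarith [h2.1]), ct_one hab h2.2.le, hση _ h2.1.le, one_mul]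
    _ = ENNReal.ofReal (∫ p, α p.2 * (u p) ^ 2 * thB (p.1 / σ p.2 ^ 2) ∂(str T)) := by
        rw [ofReal_integral_eq_lintegral_ofReal hI2]
        exact Eventually.of_forall fun p =>
          mul_nonneg (mul_nonneg (hα0 _) (sq_nonneg _)) (thB_nonneg _)
    _ ≤ _ := by
        refine ENNReal.ofReal_le_ofReal ?_
        have := mul_le_mul_of_nonneg_left hσint
          (mul_nonneg zero_le_two integral_thB_nonneg)
        linarith

lemma caseE {T : ℝ} {u : ℝ × ℝ → ℝ} {u₀ : ℝ → ℝ} (hu : IsWeakSolution T u u₀)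
    {a b : ℝ} (hab : a < b) (hb : b < T) :
    ∃ C : ℝ, 0 ≤ C ∧ ∀ ρ t₀ : ℝ, 0 < ρ → 0 < t₀ →
    ∫⁻ p, (univ ×ˢ Ioo t₀ a).indicator
      (fun p : ℝ × ℝ => ENNReal.ofReal ((u p) ^ 2 * thB (p.1 / ρ))) p ∂(str T) ≤
    ENNReal.ofReal (C * (Nu T u a b (2 * ρ) + ρ / t₀)) := by
  obtain ⟨K, hK, hKd⟩ := ct_deriv_bdd hab
  obtain ⟨KS, hKS0, hKS⟩ := dS_bdd
  have hB := integral_thB_nonneg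
  refine ⟨2 * K + 8 * (∫ y, thB y) * KS ^ 2, by positivity, fun ρ t₀ hρ ht₀ => ?_⟩
  rcases le_or_gt a t₀ with h | hta
  · rw [Ioo_eq_empty (not_lt.2 h)]; simp
  obtain ⟨K', h⟩ := caseE_fixed hu hab hb hKd hKS ht₀ hta
  have h2 := h (√ρ)
  rw [Real.sq_sqrt hρ.le] at h2
  have hlim : Tendsto (fun l : ℝ => ENNReal.ofReal (2 * (K' * Nu T u (t₀ / 4) (t₀ / 2) (2 * l ^ 2) +
      K * Nu T u a b (2 * ρ) + 2 * (∫ y, thB y) * (2 * KS ^ 2 * (ρ / t₀)))))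
      (nhdsWithin 0 (Ioi 0)) (nhds (ENNReal.ofReal (2 * (K' * 0 +
      K * Nu T u a b (2 * ρ) + 2 * (∫ y, thB y) * (2 * KS ^ 2 * (ρ / t₀)))))) := by
    refine ENNReal.tendsto_ofReal ?_
    refine Tendsto.const_mul _ (Tendsto.add_const _ (Tendsto.add_const _ (Tendsto.const_mul _ ?_)))
    refine (Nu_tendsto hu (s := t₀ / 4) (b := t₀ / 2) (by positivity) (by linarith)).comp ?_
    rw [tendsto_nhdsWithin_iff]
    constructor
    · have : Tendsto (fun l : ℝ => 2 * l ^ 2) (nhds 0) (nhds (2 * 0 ^ 2)) :=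
        (by fun_prop : Continuous fun l : ℝ => 2 * l ^ 2).tendsto 0
      simp only [ne_eq, OfNat.ofNat_ne_zero, not_false_eq_true, zero_pow, mul_zero] at this
      exact this.mono_left nhdsWithin_le_nhds
    · filter_upwards [self_mem_nhdsWithin] with l hl
      have : (0:ℝ) < l := hl
      show 0 < 2 * l ^ 2
      positivity
  refine (ge_of_tendsto hlim ?_).trans (ENNReal.ofReal_le_ofReal ?_)
  · filter_upwards [Ioo_mem_nhdsGT (Real.sqrt_pos.2 hρ)] with l hl using h2 l hl.1 hl.2
  · have := Nu_nonneg T u a b (2 * ρ)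
    have h5 : 0 ≤ ρ / t₀ := by positivity
    have h6 : 0 ≤ (∫ y, thB y) * KS ^ 2 := by positivity
    nlinarith [mul_nonneg h6 this, mul_nonneg hK.le h5]

/-- the shell functional -/
noncomputable def Dsh (T : ℝ) (u : ℝ × ℝ → ℝ) (ψ : ℝ → ℝ) (ρ : ℝ) : ENNReal :=
  ∫⁻ p, ENNReal.ofReal (ψ p.2 * (u p) ^ 2 * thB (p.1 / ρ)) ∂(str T)

lemma aem_shell {T : ℝ} {u : ℝ × ℝ → ℝ} {u₀ : ℝ → ℝ} (hu : IsWeakSolution T u u₀)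
    {ψ : ℝ → ℝ} (hψ : Continuous ψ) (ρ : ℝ) :
    AEMeasurable (fun p : ℝ × ℝ => ENNReal.ofReal (ψ p.2 * (u p) ^ 2 * thB (p.1 / ρ))) (str T) := by
  refine AEMeasurable.ennreal_ofReal ?_
  exact ((hψ.comp continuous_snd).aemeasurable.mul ((u_aesm hu).aemeasurable.pow_const 2)).mul
    (thB_cont.comp (continuous_fst.div_const ρ)).aemeasurable

lemma final_step {T : ℝ} {u : ℝ × ℝ → ℝ} {u₀ : ℝ → ℝ} (hu : IsWeakSolution T u u₀)
    {ψ : ℝ → ℝ} (hψ : Continuous ψ) (hψpos : ∀ t, 0 ≤ ψ t)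
    (hD : Tendsto (Dsh T u ψ) (nhdsWithin 0 (Ioi 0)) (nhds 0)) :
    Tendsto (fun ε : ℝ => (1 / ε) * ∫ t in Ioo (0 : ℝ) T, ∫ x in Ioo (-ε) ε,
        |x| * (u (x, t)) ^ 2 * ψ t)
      (nhdsWithin 0 (Ioi 0)) (nhds 0) := by
  obtain ⟨p, q, c, hp, hpq, hc, hsh⟩ := thB_shell
  have hq : 0 < q := hp.trans hpq
  set r := p / q with hr
  have hr0 : 0 < r := by positivity
  have hr1 : r < 1 := (div_lt_one hq).2 hpq
  set M : ENNReal := ∑' k : ℕ, ENNReal.ofReal (r ^ k / c) with hM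
  have hMtop : M ≠ ⊤ :=
    ((summable_geometric_of_lt_one hr0.le hr1).div_const c).tsum_ofReal_ne_top
  -- main bound
  have key : ∀ ε : ℝ, 0 < ε → ‖(1 / ε) * ∫ t in Ioo (0 : ℝ) T, ∫ x in Ioo (-ε) ε,
        |x| * (u (x, t)) ^ 2 * ψ t‖ₑ ≤
      ∑' k : ℕ, ENNReal.ofReal (r ^ k / c) * Dsh T u ψ (r ^ k * ε / q) := by
    intro ε hε
    set g : ℕ → ℝ × ℝ → ENNReal := fun k z => ENNReal.ofReal (r ^ k / c) *
      ENNReal.ofReal (ψ z.2 * (u z) ^ 2 * thB (z.1 / (r ^ k * ε / q))) with hg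
    have hgm : ∀ k, AEMeasurable (g k) (str T) := fun k => (aem_shell hu hψ _).const_mul _
    calc _ = ‖∫ t in Ioo (0 : ℝ) T, ∫ x in Ioo (-ε) ε,
            (1 / ε) * (|x| * (u (x, t)) ^ 2 * ψ t)‖ₑ := by
          simp only [integral_const_mul]
      _ ≤ ∫⁻ t in Ioo (0 : ℝ) T, ∫⁻ x in Ioo (-ε) ε,
            ‖(1 / ε) * (|x| * (u (x, t)) ^ 2 * ψ t)‖ₑ := by
          refine (enorm_integral_le_lintegral_enorm _).trans ?_
          exact lintegral_mono fun t => enorm_integral_le_lintegral_enorm _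
      _ ≤ ∫⁻ t in Ioo (0 : ℝ) T, ∫⁻ x, ∑' k, g k (x, t) := by
          refine lintegral_mono fun t => ?_
          rw [← lintegral_indicator measurableSet_Ioo]
          have hne : ∀ᵐ x : ℝ, x ≠ 0 := by rw [ae_iff]; simp
          refine lintegral_mono_ae ?_
          filter_upwards [hne] with x hx
          by_cases hxe : x ∈ Ioo (-ε) ε
          swap
          · rw [indicator_of_notMem hxe]; exact zero_le
          rw [indicator_of_mem hxe]
          have hx0 : 0 < |x| := abs_pos.2 hx
          have hx1 : |x| / ε ≤ 1 := (div_le_one hε).2 (abs_lt.2 hxe).le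
          obtain ⟨k, hk1, hk2⟩ := exists_nat_pow_near_of_lt_one (div_pos hx0 hε) hx1 hr0 hr1
          refine le_trans ?_ (ENNReal.le_tsum k)
          simp only [hg]
          have hrk : 0 < r ^ k := by positivity
          have hB : c ≤ thB (x / (r ^ k * ε / q)) := by
            have hpos : 0 < r ^ k * ε / q := by positivity
            apply hsh
            · rw [abs_div, abs_of_pos hpos, le_div_iff₀ hpos]
              rw [lt_div_iff₀ hε, pow_succ] at hk1
              have : p * (r ^ k * ε / q) = r ^ k * r * ε := by rw [hr]; ring
              linarith
            · rw [abs_div, abs_of_pos hpos, div_le_iff₀ hpos]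
              rw [div_le_iff₀ hε] at hk2
              have : q * (r ^ k * ε / q) = r ^ k * ε := by field_simp
              linarith
          have hnn : 0 ≤ ψ t * (u (x, t)) ^ 2 := mul_nonneg (hψpos t) (sq_nonneg _)
          rw [← ENNReal.ofReal_mul (by positivity), Real.enorm_eq_ofReal (by
            have := hψpos t; positivity)]
          refine ENNReal.ofReal_le_ofReal ?_
          calc (1 / ε) * (|x| * (u (x, t)) ^ 2 * ψ t) = (|x| / ε) * (ψ t * (u (x, t)) ^ 2) := by ring
            _ ≤ r ^ k * (ψ t * (u (x, t)) ^ 2) := by gcongr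
            _ = r ^ k / c * (ψ t * (u (x, t)) ^ 2 * c) := by field_simp
            _ ≤ _ := by gcongr
      _ = ∫⁻ z, ∑' k, g k z ∂(str T) :=
          (lintegral_prod_symm _ (AEMeasurable.tsum hgm)).symm
      _ = ∑' k, ∫⁻ z, g k z ∂(str T) := lintegral_tsum hgm
      _ = _ := by
          congr 1
          funext k
          exact lintegral_const_mul'' _ (aem_shell hu hψ _)
  rw [tendsto_zero_iff_enorm_tendsto_zero, ENNReal.tendsto_nhds_zero]
  intro δ hδ
  have hδM : 0 < δ / M := ENNReal.div_pos hδ.ne' hMtop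
  have h1 := (ENNReal.tendsto_nhds_zero.1 hD) _ hδM
  rw [eventually_nhdsWithin_iff, Metric.eventually_nhds_iff] at h1
  obtain ⟨ρ₀, hρ₀, h1⟩ := h1
  filter_upwards [Ioo_mem_nhdsGT (mul_pos hρ₀ hq)] with ε hε
  refine (key ε hε.1).trans ?_
  calc _ ≤ ∑' k : ℕ, ENNReal.ofReal (r ^ k / c) * (δ / M) := by
        refine ENNReal.tsum_le_tsum fun k => ?_
        have hpos : 0 < r ^ k * ε / q := by have := hε.1; positivity
        refine mul_le_mul_right (h1 ?_ hpos) _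
        rw [Real.dist_eq, sub_zero, abs_of_pos hpos, div_lt_iff₀ hq]
        have : r ^ k ≤ 1 := pow_le_one₀ hr0.le hr1.le
        nlinarith [hε.1, hε.2]
    _ = M * (δ / M) := ENNReal.tsum_mul_right
    _ ≤ δ := ENNReal.mul_div_le

lemma caseA {T : ℝ} {u : ℝ × ℝ → ℝ} {u₀ : ℝ → ℝ} (hu : IsWeakSolution T u u₀)
    {ψ : ℝ → ℝ} {a b L : ℝ} (ha : 0 < a) (hab : a < b) (hb : b < T)
    (hL : 0 ≤ L) (hψL : ∀ t, 0 < t → ψ t ≤ L * t ^ 2) (hψa : ∀ t, a ≤ t → ψ t = 0) :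
    Tendsto (Dsh T u ψ) (nhdsWithin 0 (Ioi 0)) (nhds 0) := by
  obtain ⟨C, hC, hE⟩ := caseE hu hab hb
  have hbound : ∀ ρ, 0 < ρ → Dsh T u ψ ρ ≤ ENNReal.ofReal L *
      (ENNReal.ofReal (2 * C * (a * Nu T u a b (2 * ρ) + ρ)) * ENNReal.ofReal a) := by
    intro ρ hρ
    have hN := Nu_nonneg T u a b (2 * ρ)
    set f : ℝ × ℝ → ENNReal := fun p => ENNReal.ofReal ((u p) ^ 2 * thB (p.1 / ρ)) with hf
    have hfm : AEMeasurable f (str T) :=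
      (((u_aesm hu).aemeasurable.pow_const 2).mul
        (thB_cont.comp (continuous_fst.div_const ρ)).aemeasurable).ennreal_ofReal
    set G : ℝ × ℝ → ℝ → ENNReal := fun p s => (univ ×ˢ Ioo s a).indicator f p * ENNReal.ofReal (2 * s)
      with hG
    have hGm : AEMeasurable (Function.uncurry G) ((str T).prod (volume.restrict (Ioo 0 a))) := by
      have e : Function.uncurry G = fun z => ({z : (ℝ × ℝ) × ℝ | z.2 < z.1.2 ∧ z.1.2 < a}.indicator
          (fun z => f z.1) z) * ENNReal.ofReal (2 * z.2) := by
        funext z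
        obtain ⟨p, s⟩ := z
        simp only [hG, Function.uncurry]
        congr 1
        by_cases h : s < p.2 ∧ p.2 < a
        · rw [indicator_of_mem, indicator_of_mem]
          · exact h
          · exact ⟨mem_univ _, h⟩
        · rw [indicator_of_notMem, indicator_of_notMem]
          · exact h
          · exact fun h' => h h'.2
      rw [e]
      refine AEMeasurable.mul (AEMeasurable.indicator hfm.comp_fst ?_) ?_
      · exact (measurableSet_lt measurable_snd (measurable_snd.comp measurable_fst)).inter
          (measurableSet_lt (measurable_snd.comp measurable_fst) measurable_const)
      · exact ((measurable_snd.const_mul 2).ennreal_ofReal).aemeasurable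
    have hpt : ∀ᵐ p ∂(str T), ENNReal.ofReal (ψ p.2 * (u p) ^ 2 * thB (p.1 / ρ)) ≤
        ENNReal.ofReal L * ∫⁻ s in Ioo 0 a, G p s := by
      have hpos : ∀ᵐ p ∂(str T), 0 < p.2 := by
        rw [str_eq]
        filter_upwards [ae_restrict_mem (MeasurableSet.univ.prod measurableSet_Ioo)] with p hp
        exact hp.2.1
      filter_upwards [hpos] with p hp
      rcases le_or_gt a p.2 with h | h
      · rw [hψa _ h]; simp
      have e : ENNReal.ofReal (p.2 ^ 2) = ∫⁻ s in Ioo 0 p.2, ENNReal.ofReal (2 * s) := by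
        rw [← ofReal_integral_eq_lintegral_ofReal]
        · congr 1
          rw [← integral_Ioc_eq_integral_Ioo, ← intervalIntegral.integral_of_le hp.le,
            intervalIntegral.integral_const_mul, integral_id]
          ring
        · exact ((by fun_prop : Continuous fun s : ℝ => 2 * s).integrableOn_Icc).mono_set
            Ioo_subset_Icc_self
        · filter_upwards [ae_restrict_mem measurableSet_Ioo] with s hs
          have := hs.1
          show 0 ≤ 2 * s
          linarith
      have hw : 0 ≤ (u p) ^ 2 * thB (p.1 / ρ) := mul_nonneg (sq_nonneg _) (thB_nonneg _)
      calc ENNReal.ofReal (ψ p.2 * (u p) ^ 2 * thB (p.1 / ρ))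
          ≤ ENNReal.ofReal (L * (p.2 ^ 2 * ((u p) ^ 2 * thB (p.1 / ρ)))) := by
            refine ENNReal.ofReal_le_ofReal ?_
            rw [mul_assoc, ← mul_assoc L]
            exact mul_le_mul_of_nonneg_right (hψL _ hp) hw
        _ = ENNReal.ofReal L * (f p * ∫⁻ s in Ioo 0 p.2, ENNReal.ofReal (2 * s)) := by
            rw [ENNReal.ofReal_mul hL, ENNReal.ofReal_mul (sq_nonneg _), e, mul_comm (f p)]
        _ = ENNReal.ofReal L * ∫⁻ s in Ioo 0 p.2, G p s := by
            congr 1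
            rw [← lintegral_const_mul _ (by fun_prop)]
            refine setLIntegral_congr_fun measurableSet_Ioo fun s hs => ?_
            simp only [hG]
            rw [indicator_of_mem]
            exact ⟨mem_univ _, hs.2, h⟩
        _ ≤ _ := by
            refine mul_le_mul_right ?_ _
            exact lintegral_mono_set (Ioo_subset_Ioo le_rfl h.le)
    calc Dsh T u ψ ρ ≤ ∫⁻ p, ENNReal.ofReal L * (∫⁻ s in Ioo 0 a, G p s) ∂(str T) :=
          lintegral_mono_ae hpt
      _ = ENNReal.ofReal L * ∫⁻ p, (∫⁻ s in Ioo 0 a, G p s) ∂(str T) :=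
          lintegral_const_mul' _ _ ENNReal.ofReal_ne_top
      _ = ENNReal.ofReal L * ∫⁻ s in Ioo 0 a, ∫⁻ p, G p s ∂(str T) := by
          rw [lintegral_lintegral_swap hGm]
      _ ≤ ENNReal.ofReal L * ∫⁻ s in Ioo 0 a,
            ENNReal.ofReal (2 * C * (a * Nu T u a b (2 * ρ) + ρ)) := by
          refine mul_le_mul_right ?_ _
          refine setLIntegral_mono measurable_const fun s hs => ?_
          simp only [hG]
          rw [lintegral_mul_const' _ _ ENNReal.ofReal_ne_top]
          refine (mul_le_mul_left (hE ρ s hρ hs.1) _).trans ?_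
          have hs1 := hs.1
          rw [← ENNReal.ofReal_mul (by positivity)]
          refine ENNReal.ofReal_le_ofReal ?_
          have e : C * (Nu T u a b (2 * ρ) + ρ / s) * (2 * s) =
            2 * C * (s * Nu T u a b (2 * ρ) + ρ) := by field_simp
          rw [e]
          have := hs.2.le
          gcongr
      _ = _ := by
          rw [setLIntegral_const, Real.volume_Ioo, sub_zero]
  have hlim : Tendsto (fun ρ : ℝ => ENNReal.ofReal L *
      (ENNReal.ofReal (2 * C * (a * Nu T u a b (2 * ρ) + ρ)) * ENNReal.ofReal a))
      (nhdsWithin 0 (Ioi 0)) (nhds (ENNReal.ofReal L *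
      (ENNReal.ofReal (2 * C * (a * 0 + 0)) * ENNReal.ofReal a))) := by
    refine ENNReal.Tendsto.const_mul (ENNReal.Tendsto.mul_const (ENNReal.tendsto_ofReal ?_)
      (Or.inr ENNReal.ofReal_ne_top)) (Or.inr ENNReal.ofReal_ne_top)
    refine Tendsto.const_mul _ (Tendsto.add (Tendsto.const_mul _ ?_) ?_)
    · refine (Nu_tendsto hu ha hb).comp ?_
      rw [tendsto_nhdsWithin_iff]
      constructor
      · have : Tendsto (fun l : ℝ => 2 * l) (nhds 0) (nhds (2 * 0)) :=
          (by fun_prop : Continuous fun l : ℝ => 2 * l).tendsto 0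
        rw [mul_zero] at this
        exact this.mono_left nhdsWithin_le_nhds
      · filter_upwards [self_mem_nhdsWithin] with l hl
        have : (0:ℝ) < l := hl
        show 0 < 2 * l
        positivity
    · exact tendsto_id.mono_left nhdsWithin_le_nhds
  simp only [mul_zero, add_zero, ENNReal.ofReal_zero, zero_mul] at hlim
  refine tendsto_of_tendsto_of_tendsto_of_le_of_le' tendsto_const_nhds hlim
    (Eventually.of_forall fun _ => zero_le) ?_
  filter_upwards [self_mem_nhdsWithin] with ρ hρ using hbound ρ hρ

lemma str_mem (T : ℝ) : ∀ᵐ p ∂(str T), p.2 ∈ Ioo 0 T := by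
  rw [str_eq]
  filter_upwards [ae_restrict_mem (MeasurableSet.univ.prod measurableSet_Ioo)] with p hp
  exact hp.2

lemma slice_int {T : ℝ} {u : ℝ × ℝ → ℝ} {u₀ : ℝ → ℝ} (hu : IsWeakSolution T u u₀) (ε : ℝ) :
    ∀ᵐ t ∂(volume.restrict (Ioo 0 T)), IntegrableOn (fun x => x * (u (x, t)) ^ 2) (Ioo (-ε) ε) := by
  have h : ∀ n : ℕ, ∀ᵐ t : ℝ, Integrable (fun x : ℝ =>
      (Icc (-ε) ε ×ˢ Icc (1 / ((n : ℝ) + 1)) (T - 1 / ((n : ℝ) + 1))).indicator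
        (fun p : ℝ × ℝ => p.1 * (u p) ^ 2) (x, t)) := by
    intro n
    have hn : 0 < 1 / ((n : ℝ) + 1) := by positivity
    have := (box_int hu.2.1 hn (b := T - 1 / ((n : ℝ) + 1)) (by linarith) ε)
    rw [← integrable_indicator_iff (meas_box _ _ _), Measure.volume_eq_prod] at this
    exact this.prod_left_ae
  rw [ae_restrict_iff' measurableSet_Ioo]
  filter_upwards [ae_all_iff.2 h] with t ht htT
  obtain ⟨n, hn⟩ := exists_nat_one_div_lt (lt_min htT.1 (sub_pos.2 htT.2))
  have h1 := lt_of_lt_of_le hn (min_le_left _ _)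
  have h2 := lt_of_lt_of_le hn (min_le_right _ _)
  refine (ht n).integrableOn.congr_fun (fun x hx => ?_) measurableSet_Ioo
  show indicator _ _ _ = _
  rw [indicator_of_mem]
  exact ⟨Ioo_subset_Icc_self hx, h1.le, by show t ≤ _; linarith⟩

lemma caseB {T : ℝ} {u : ℝ × ℝ → ℝ} {u₀ : ℝ → ℝ} (hu : IsWeakSolution T u u₀)
    (hu₀ : LocallyIntegrable u₀)
    {ψ : ℝ → ℝ} (hψ : Continuous ψ) (hψpos : ∀ t, 0 ≤ ψ t) (hψ0 : 0 < ψ 0) {L : ℝ}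
    (hL : ∀ t, ψ t ≤ L)
    {a b : ℝ} (ha : 0 < a) (hab : a < b) (hb : b < T)
    (hψa : ∀ t, a ≤ t → ψ t = 0) {ε₀ : ℝ} (hε₀ : 0 < ε₀)
    (hI : Integrable (fun t => ∫ x in Ioo (-ε₀) ε₀, |x| * (u (x, t)) ^ 2 * ψ t)
      (volume.restrict (Ioo 0 T))) :
    Tendsto (Dsh T u ψ) (nhdsWithin 0 (Ioi 0)) (nhds 0) := by
  obtain ⟨K, hK, hKd⟩ := ct_deriv_bdd hab
  obtain ⟨KS, hKS0, hKS⟩ := dS_bdd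
  have hL0 : 0 ≤ L := (hψpos 0).trans (hL 0)
  -- integrability of the flux near the interface
  set Q : ℝ × ℝ → ℝ := fun p => (Ioo (-ε₀) ε₀).indicator (fun x => |x| * (u (x, p.2)) ^ 2 * ψ p.2) p.1
    with hQ
  have hQnn : ∀ p, 0 ≤ Q p := fun p => indicator_nonneg (fun x _ =>
    mul_nonneg (mul_nonneg (abs_nonneg _) (sq_nonneg _)) (hψpos _)) _
  have hQm : AEStronglyMeasurable Q (str T) := by
    have e : Q = (Ioo (-ε₀) ε₀ ×ˢ univ).indicator (fun p : ℝ × ℝ => |p.1| * (u p) ^ 2 * ψ p.2) := by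
      funext p
      simp only [hQ]
      by_cases h : p.1 ∈ Ioo (-ε₀) ε₀
      · rw [indicator_of_mem h, indicator_of_mem]
        exact ⟨h, mem_univ _⟩
      · rw [indicator_of_notMem h, indicator_of_notMem]
        exact fun h' => h h'.1
    rw [e]
    refine AEStronglyMeasurable.indicator ?_ (measurableSet_Ioo.prod MeasurableSet.univ)
    exact ((continuous_fst.abs.aestronglyMeasurable).mul ((u_aesm hu).pow 2)).mul
      (hψ.comp continuous_snd).aestronglyMeasurable
  have hQi : Integrable Q (str T) := by
    refine (integrable_prod_iff' hQm).2 ⟨?_, ?_⟩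
    · filter_upwards [slice_int hu ε₀] with t ht
      simp only [hQ]
      rw [integrable_indicator_iff measurableSet_Ioo]
      refine ((ht.abs).mul_const (ψ t)).congr (Eventually.of_forall fun x => ?_)
      show |x * (u (x, t)) ^ 2| * ψ t = |x| * (u (x, t)) ^ 2 * ψ t
      rw [abs_mul, abs_of_nonneg (sq_nonneg (u (x, t)))]
    · refine hI.congr (Eventually.of_forall fun t => ?_)
      show ∫ x in Ioo (-ε₀) ε₀, |x| * (u (x, t)) ^ 2 * ψ t = ∫ x, ‖Q (x, t)‖
      rw [← integral_indicator measurableSet_Ioo]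
      congr 1
      funext x
      rw [Real.norm_eq_abs, abs_of_nonneg (hQnn _)]
  obtain ⟨s, hs, hsψ⟩ : ∃ s > 0, ∀ t, 0 < t → t < s → ψ 0 / 2 ≤ ψ t := by
    have : ∀ᶠ t in nhds 0, ψ 0 / 2 < ψ t := hψ.continuousAt.eventually (lt_mem_nhds (by linarith))
    obtain ⟨s, hs, h⟩ := Metric.eventually_nhds_iff.1 this
    refine ⟨s, hs, fun t h1 h2 => (h ?_).le⟩
    rw [Real.dist_eq, sub_zero, abs_of_pos h1]; exact h2
  set α : ℝ → ℝ := fun t => Real.smoothTransition (t + 2) * ct a b t with hα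
  have hαs : ContDiff ℝ (⊤ : ℕ∞) α := (S_smooth.comp (by fun_prop)).mul (ct_smooth a b)
  have hα0 : ∀ t, 0 ≤ α t := fun t => mul_nonneg (Real.smoothTransition.nonneg _) (ct_nonneg _ _ _)
  have hα1 : ∀ t, α t ≤ 1 := fun t =>
    mul_le_one₀ (Real.smoothTransition.le_one _) (ct_nonneg _ _ _) (ct_le_one _ _ _)
  have hsupp : ∀ t, t ∉ Icc (-2) b → α t = 0 := by
    intro t ht
    rw [mem_Icc, not_and_or, not_le, not_le] at ht
    rcases ht with h | h
    · simp only [hα]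
      rw [Real.smoothTransition.zero_of_nonpos (by linarith), zero_mul]
    · simp only [hα]; rw [ct_zero hab h.le, mul_zero]
  have hct : ∀ t, -1 ≤ t → α t = ct a b t := by
    intro t ht
    simp only [hα]
    rw [Real.smoothTransition.one_of_one_le (by linarith), one_mul]
  have hd1 : ∀ t, -1 < t → deriv α t = deriv (ct a b) t := by
    intro t ht
    refine Filter.EventuallyEq.deriv_eq ?_
    filter_upwards [Ioi_mem_nhds ht] with w hw using hct w (le_of_lt hw)
  have hd2 : ∀ t, t ∉ Icc a b → deriv (ct a b) t = 0 := by
    intro t ht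
    rw [mem_Icc, not_and_or, not_le, not_le] at ht
    rcases ht with h | h
    · have : ct a b =ᶠ[nhds t] fun _ => 1 := by
        filter_upwards [Iio_mem_nhds h] with w hw using ct_one hab (le_of_lt hw)
      rw [this.deriv_eq]; simp
    · have : ct a b =ᶠ[nhds t] fun _ => 0 := by
        filter_upwards [Ioi_mem_nhds h] with w hw using ct_zero hab (le_of_lt hw)
      rw [this.deriv_eq]; simp
  have hα00 : α 0 = 1 := by rw [hct 0 (by norm_num), ct_one hab ha.le]
  have hbound : ∀ ρ, 0 < ρ → 2 * ρ < ε₀ → Dsh T u ψ ρ ≤ ENNReal.ofReal (L *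
      (2 * (K * Nu T u a b (2 * ρ) + ∫ x, u₀ x * th (x / ρ)))) := by
    intro ρ hρ hρε
    have hy : ∀ x : ℝ, |x / ρ| ≤ 2 → |x| ≤ 2 * ρ := by
      intro x h1
      rwa [abs_div, abs_of_pos hρ, div_le_iff₀ hρ] at h1
    have hsq : √ρ ^ 2 = ρ := Real.sq_sqrt hρ.le
    have hI1' : Integrable (fun p : ℝ × ℝ => u p * (deriv (ct a b) p.2 * th (p.1 / ρ))) (str T) := by
      refine loc_int hu.1 ha hb (M := 2 * ρ)
        ((((ct_smooth a b).continuous_deriv (by simp)).comp continuous_snd).mul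
          (th_smooth.continuous.comp (continuous_fst.div_const ρ))) ?_
      intro p hp
      refine ⟨abs_le.1 (hy _ ?_), ?_⟩
      · by_contra h
        exact hp (by simp [th_zero (not_le.1 h)])
      · by_contra h
        exact hp (by simp [hd2 _ h])
    have hcongr : (fun p : ℝ × ℝ => u p * (deriv (ct a b) p.2 * th (p.1 / ρ))) =ᵐ[str T]
        (fun p : ℝ × ℝ => u p * (deriv α p.2 * th (p.1 / ρ))) := by
      filter_upwards [str_mem T] with p hp
      rw [hd1 _ (by linarith [hp.1])]
    have hI1 : Integrable (fun p : ℝ × ℝ => u p * (deriv α p.2 * th (p.1 / ρ))) (str T) :=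
      hI1'.congr hcongr
    have hI2 : Integrable (fun p : ℝ × ℝ => α p.2 * (u p) ^ 2 * thB (p.1 / ρ)) (str T) := by
      have hbox : Integrable ((Icc (-(2 * ρ)) (2 * ρ) ×ˢ Icc s b).indicator
          (fun p : ℝ × ℝ => |p.1 * (u p) ^ 2|)) (str T) := by
        rw [str_eq]
        refine Integrable.restrict ?_
        rw [integrable_indicator_iff (meas_box _ _ _)]
        exact (box_int hu.2.1 hs hb (2 * ρ)).abs
      set Cd := 4 * KS / ρ with hCd
      have hCd0 : 0 < Cd := by positivity
      refine ((hQi.const_mul (Cd * (2 / ψ 0))).add (hbox.const_mul Cd)).mono' ?_ ?_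
      · exact (((hαs.continuous.comp continuous_snd).aestronglyMeasurable).mul
          ((u_aesm hu).pow 2)).mul
          (thB_cont.comp (continuous_fst.div_const ρ)).aestronglyMeasurable
      · filter_upwards [str_mem T] with p hp
        rw [Real.norm_eq_abs, abs_of_nonneg
          (mul_nonneg (mul_nonneg (hα0 _) (sq_nonneg _)) (thB_nonneg _))]
        have n1 : 0 ≤ Cd * (2 / ψ 0) * Q p := mul_nonneg (by positivity) (hQnn p)
        have n2 : 0 ≤ Cd * (Icc (-(2 * ρ)) (2 * ρ) ×ˢ Icc s b).indicator
          (fun p : ℝ × ℝ => |p.1 * (u p) ^ 2|) p :=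
          mul_nonneg hCd0.le (indicator_nonneg (fun _ _ => abs_nonneg _) _)
        show α p.2 * (u p) ^ 2 * thB (p.1 / ρ) ≤ Cd * (2 / ψ 0) * Q p +
          Cd * (Icc (-(2 * ρ)) (2 * ρ) ×ˢ Icc s b).indicator
          (fun p : ℝ × ℝ => |p.1 * (u p) ^ 2|) p
        by_cases h2 : |p.1 / ρ| ≤ 2
        swap
        · rw [thB_zero (not_le.1 h2), mul_zero]; linarith
        have hx := hy _ h2
        have hthB : thB (p.1 / ρ) ≤ Cd * |p.1| := by
          have e : thB (p.1 / ρ) = 2 * |p.1 / ρ| * |p.1 / ρ| * dS (2 - (p.1 / ρ) ^ 2) := by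
            rw [thB, ← sq_abs (p.1 / ρ)]; ring
          rw [e]
          calc 2 * |p.1 / ρ| * |p.1 / ρ| * dS (2 - (p.1 / ρ) ^ 2)
              ≤ 2 * 2 * |p.1 / ρ| * KS := by
                have := hKS (2 - (p.1 / ρ) ^ 2)
                have := dS_nonneg (2 - (p.1 / ρ) ^ 2)
                gcongr
            _ = Cd * |p.1| := by
                rw [abs_div, abs_of_pos hρ, hCd]; ring
        have hmain : α p.2 * (u p) ^ 2 * thB (p.1 / ρ) ≤ Cd * (|p.1| * (u p) ^ 2) := by
          calc α p.2 * (u p) ^ 2 * thB (p.1 / ρ) ≤ 1 * (u p) ^ 2 * (Cd * |p.1|) := by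
                have := hα1 p.2
                have := thB_nonneg (p.1 / ρ)
                gcongr
            _ = _ := by ring
        rcases lt_or_ge p.2 s with h3 | h3
        · have hQp : Q p = |p.1| * (u p) ^ 2 * ψ p.2 := by
            simp only [hQ]
            rw [indicator_of_mem]
            exact abs_lt.1 (by linarith)
          have h4 := hsψ _ hp.1 h3
          have h5 : |p.1| * (u p) ^ 2 ≤ 2 / ψ 0 * Q p := by
            rw [hQp]
            have h6 : 1 ≤ 2 / ψ 0 * ψ p.2 := by
              rw [div_mul_eq_mul_div, le_div_iff₀ hψ0]; linarith
            have h7 : 0 ≤ |p.1| * (u p) ^ 2 := by positivity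
            nlinarith [mul_le_mul_of_nonneg_left h6 h7]
          have := mul_le_mul_of_nonneg_left h5 hCd0.le
          linarith
        rcases le_or_gt p.2 b with h4 | h4
        · rw [indicator_of_mem (show p ∈ Icc (-(2 * ρ)) (2 * ρ) ×ˢ Icc s b from
            ⟨abs_le.1 hx, h3, h4⟩)] at n2 ⊢
          rw [abs_mul, abs_of_nonneg (sq_nonneg (u p))]
          linarith
        · rw [hsupp _ (fun h => by have := h.2; linarith)]
          simp only [zero_mul]
          linarith
    have hL' := mainL hu (σ := fun _ => √ρ) hαs contDiff_const (fun _ => Real.sqrt_pos.2 hρ)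
      hα0 hα1 hb hsupp (by simpa only [hsq] using hI1) (by simpa only [hsq] using hI2)
    simp only [hsq, hα00, one_mul, deriv_const, ne_eq, OfNat.ofNat_ne_zero, not_false_eq_true,
      zero_pow, integral_zero, mul_zero, add_zero] at hL'
    have hIle : ∫ p, u p * (deriv α p.2 * th (p.1 / ρ)) ∂(str T) ≤ K * Nu T u a b (2 * ρ) := by
      rw [← integral_congr_ae hcongr]
      have i2 := ind_int hu (s := a) (b := b) ha hb (2 * ρ)
      unfold Nu
      rw [← integral_const_mul]
      refine integral_mono hI1' (i2.const_mul _) fun p => ?_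
      show u p * (deriv (ct a b) p.2 * th (p.1 / ρ)) ≤
        K * (Icc (-(2 * ρ)) (2 * ρ) ×ˢ Icc a b).indicator (fun p => |u p|) p
      by_cases hp : p ∈ Icc (-(2 * ρ)) (2 * ρ) ×ˢ Icc a b
      · rw [indicator_of_mem hp]
        refine (le_abs_self _).trans ?_
        rw [abs_mul, abs_mul, abs_of_nonneg (th_nonneg _), mul_comm]
        refine mul_le_mul_of_nonneg_right ?_ (abs_nonneg _)
        exact (mul_le_of_le_one_right (abs_nonneg _) (th_le_one _)).trans (hKd _)
      · rw [indicator_of_notMem hp, mul_zero]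
        by_cases h : p.2 ∈ Icc a b
        · rw [th_zero]
          · simp
          · by_contra h'
            exact hp ⟨abs_le.1 (hy _ (not_lt.1 h')), h⟩
        · rw [hd2 _ h]; simp
    calc Dsh T u ψ ρ ≤ ∫⁻ p, ENNReal.ofReal (L * (α p.2 * (u p) ^ 2 * thB (p.1 / ρ))) ∂(str T) := by
          refine lintegral_mono_ae ?_
          filter_upwards [str_mem T] with p hp
          refine ENNReal.ofReal_le_ofReal ?_
          have h1 : ψ p.2 ≤ L * α p.2 := by
            rcases le_or_gt a p.2 with h | h
            · rw [hψa _ h]; exact mul_nonneg hL0 (hα0 _)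
            · rw [hct _ (by linarith [hp.1]), ct_one hab h.le, mul_one]; exact hL _
          have := mul_le_mul_of_nonneg_right h1
            (mul_nonneg (sq_nonneg (u p)) (thB_nonneg (p.1 / ρ)))
          linarith
      _ = ENNReal.ofReal (∫ p, L * (α p.2 * (u p) ^ 2 * thB (p.1 / ρ)) ∂(str T)) := by
          rw [ofReal_integral_eq_lintegral_ofReal (hI2.const_mul L)]
          exact Eventually.of_forall fun p => mul_nonneg hL0
            (mul_nonneg (mul_nonneg (hα0 _) (sq_nonneg _)) (thB_nonneg _))
      _ ≤ _ := by
          refine ENNReal.ofReal_le_ofReal ?_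
          rw [integral_const_mul]
          refine mul_le_mul_of_nonneg_left ?_ hL0
          linarith
  have hlim : Tendsto (fun ρ : ℝ => ENNReal.ofReal (L *
      (2 * (K * Nu T u a b (2 * ρ) + ∫ x, u₀ x * th (x / ρ)))))
      (nhdsWithin 0 (Ioi 0)) (nhds (ENNReal.ofReal (L * (2 * (K * 0 + 0))))) := by
    refine ENNReal.tendsto_ofReal ?_
    refine Tendsto.const_mul _ (Tendsto.const_mul _ (Tendsto.add (Tendsto.const_mul _ ?_) ?_))
    · refine (Nu_tendsto hu ha hb).comp ?_
      rw [tendsto_nhdsWithin_iff]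
      constructor
      · have : Tendsto (fun l : ℝ => 2 * l) (nhds 0) (nhds (2 * 0)) :=
          (by fun_prop : Continuous fun l : ℝ => 2 * l).tendsto 0
        rw [mul_zero] at this
        exact this.mono_left nhdsWithin_le_nhds
      · filter_upwards [self_mem_nhdsWithin] with l hl
        have : (0:ℝ) < l := hl
        show 0 < 2 * l
        positivity
    · exact u0_tendsto hu₀
  simp only [mul_zero, add_zero, ENNReal.ofReal_zero] at hlim
  refine tendsto_of_tendsto_of_tendsto_of_le_of_le' tendsto_const_nhds hlim
    (Eventually.of_forall fun _ => zero_le) ?_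
  filter_upwards [Ioo_mem_nhdsGT (half_pos hε₀)] with ρ hρ
    using hbound ρ hρ.1 (by linarith [hρ.2])

lemma psi_quad {ψ : ℝ → ℝ} (hψ : ContDiff ℝ (⊤ : ℕ∞) ψ) (hψc : HasCompactSupport ψ)
    (hψpos : ∀ t, 0 ≤ ψ t) (h0 : ψ 0 = 0) :
    ∃ L : ℝ, 0 ≤ L ∧ ∀ t, 0 < t → ψ t ≤ L * t ^ 2 := by
  have hd0 : deriv ψ 0 = 0 := by
    refine IsLocalMin.deriv_eq_zero (Eventually.of_forall fun t => ?_)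
    rw [h0]; exact hψpos t
  have hd : ContDiff ℝ 1 (deriv ψ) := by
    have : ContDiff ℝ (1 + 1) ψ := hψ.of_le (by norm_cast)
    exact (contDiff_succ_iff_deriv.1 this).2.2
  obtain ⟨L, hL⟩ := hd.lipschitzWith_of_hasCompactSupport hψc.deriv (by simp)
  refine ⟨L, L.2, fun t ht => ?_⟩
  have h1 : ∀ x ∈ Icc 0 t, ‖deriv ψ x‖ ≤ L * t := by
    intro x hx
    have := hL.dist_le_mul x 0
    rw [hd0, dist_zero_right, dist_zero_right, Real.norm_eq_abs x, abs_of_nonneg hx.1] at this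
    exact this.trans (mul_le_mul_of_nonneg_left hx.2 L.2)
  have h2 := (convex_Icc (0:ℝ) t).norm_image_sub_le_of_norm_deriv_le
    (fun x _ => hψ.differentiable (by simp) x) h1 (left_mem_Icc.2 ht.le) (right_mem_Icc.2 ht.le)
  rw [h0, sub_zero, sub_zero, Real.norm_eq_abs, Real.norm_eq_abs, abs_of_pos ht] at h2
  have := le_abs_self (ψ t)
  nlinarith

lemma psi_end {ψ : ℝ → ℝ} {T : ℝ} (hT : 0 < T) (hψc : HasCompactSupport ψ)
    (hψsupp : tsupport ψ ⊆ Iio T) :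
    ∃ a, 0 < a ∧ a < T ∧ ∀ t, a ≤ t → ψ t = 0 := by
  rcases (tsupport ψ).eq_empty_or_nonempty with h | h
  · refine ⟨T / 2, by linarith, by linarith, fun t _ => ?_⟩
    exact image_eq_zero_of_notMem_tsupport (by rw [h]; simp)
  · obtain ⟨m, hm, hmax⟩ := hψc.isCompact.exists_isGreatest h
    have hmT : m < T := hψsupp hm
    refine ⟨max (T / 2) ((m + T) / 2), lt_max_of_lt_left (by linarith),
      max_lt (by linarith) (by linarith), fun t ht => ?_⟩
    refine image_eq_zero_of_notMem_tsupport fun hmem => ?_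
    have := hmax hmem
    have := (le_max_right _ _).trans ht
    linarith

theorem statement10 (T : ℝ) (hT : 0 < T) (u₀ : ℝ → ℝ) (hu₀ : LocallyIntegrable u₀)
    (u : ℝ × ℝ → ℝ) (hu : IsWeakSolution T u u₀)
    (ψ : ℝ → ℝ) (hψ : ContDiff ℝ (⊤ : ℕ∞) ψ) (hψc : HasCompactSupport ψ)
    (hψpos : ∀ t, 0 ≤ ψ t) (hψsupp : tsupport ψ ⊆ Iio T) :
    Tendsto (fun ε : ℝ => (1 / ε) * ∫ t in Ioo (0 : ℝ) T, ∫ x in Ioo (-ε) ε,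
        |x| * (u (x, t)) ^ 2 * ψ t)
      (nhdsWithin 0 (Ioi 0)) (nhds 0) := by
  obtain ⟨a, ha, haT, hψa⟩ := psi_end hT hψc hψsupp
  obtain ⟨b, hab, hb⟩ := exists_between haT
  rcases (hψpos 0).eq_or_lt with h0 | h0
  · obtain ⟨L, hL, hψL⟩ := psi_quad hψ hψc hψpos h0.symm
    exact final_step hu hψ.continuous hψpos (caseA hu ha hab hb hL hψL hψa)
  · by_cases hI : ∃ ε₀ : ℝ, 0 < ε₀ ∧ Integrable
      (fun t => ∫ x in Ioo (-ε₀) ε₀, |x| * (u (x, t)) ^ 2 * ψ t) (volume.restrict (Ioo 0 T))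
    · obtain ⟨ε₀, hε₀, hI⟩ := hI
      obtain ⟨L, hL⟩ := hψc.exists_bound_of_continuous hψ.continuous
      exact final_step hu hψ.continuous hψpos (caseB hu hu₀ hψ.continuous hψpos h0
        (fun t => (le_abs_self _).trans (hL t)) ha hab hb hψa hε₀ hI)
    · push Not at hI
      refine tendsto_const_nhds.congr' ?_
      filter_upwards [self_mem_nhdsWithin] with ε hε
      rw [integral_undef (hI ε hε), mul_zero]
end

section
/- Let u₀ : ℝ → ℝ satisfy u₀(0) < 0, u₀(x) ≤ 0 for all x, u₀ nonincreasing on (−∞,0], and u₀ nondecreasing on [0,∞). Then for every t with 0 ≤ t < −1/u₀(0): (i) for all 0 ≤ x₁ < x₂: x₁·(1 + t·u₀(x₁))² < x₂·(1 + t·u₀(x₂))²; and (ii) for all x₁ < x₂ ≤ 0: x₁·(1 + t·u₀(x₁))² < x₂·(1 + t·u₀(x₂))². That is, the forward characteristics t ↦ x·(1 + t·u₀(x))² of u_t + (x u²)_x = 0 emanating from distinct initial points of the same sign do not intersect before the blow-up time −1/u₀(0). -/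
open Set

/-- forward characteristics `t ↦ x (1 + t u₀(x))²` of `u_t + (x u²)_x = 0`
emanating from distinct initial points of the same sign do not intersect before the
blow-up time `−1/u₀(0)`, under the stated monotonicity hypotheses on the nonpositive
datum `u₀`. -/
theorem statement15 (u₀ : ℝ → ℝ) (hneg : u₀ 0 < 0) (hnp : ∀ x, u₀ x ≤ 0)
    (hdec : AntitoneOn u₀ (Iic 0)) (hinc : MonotoneOn u₀ (Ici 0)) :
    ∀ t : ℝ, 0 ≤ t → t < -1 / u₀ 0 →
      (∀ x₁ x₂ : ℝ, 0 ≤ x₁ → x₁ < x₂ →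
        x₁ * (1 + t * u₀ x₁) ^ 2 < x₂ * (1 + t * u₀ x₂) ^ 2) ∧
      (∀ x₁ x₂ : ℝ, x₁ < x₂ → x₂ ≤ 0 →
        x₁ * (1 + t * u₀ x₁) ^ 2 < x₂ * (1 + t * u₀ x₂) ^ 2) := by
  intro t ht htl
  have h0 : 0 < 1 + t * u₀ 0 := by
    rw [lt_div_iff_of_neg hneg] at htl
    linarith
  have key : ∀ a b p q : ℝ, 0 ≤ a → a < b → 0 < p → p ≤ q → a * p ^ 2 < b * q ^ 2 := by
    intro a b p q ha hab hp hpq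
    have h1 : p ^ 2 ≤ q ^ 2 := pow_le_pow_left₀ hp.le hpq 2
    have h2 : 0 < p ^ 2 := by positivity
    calc a * p ^ 2 < b * p ^ 2 := mul_lt_mul_of_pos_right hab h2
      _ ≤ b * q ^ 2 := mul_le_mul_of_nonneg_left h1 (ha.trans hab.le)
  constructor
  · intro x₁ x₂ h1 h12
    have ha := mul_le_mul_of_nonneg_left
      (hinc (mem_Ici.2 le_rfl) (mem_Ici.2 h1) h1) ht
    have hb := mul_le_mul_of_nonneg_left
      (hinc (mem_Ici.2 h1) (mem_Ici.2 (h1.trans h12.le)) h12.le) ht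
    exact key _ _ _ _ h1 h12 (by linarith) (by linarith)
  · intro x₁ x₂ h12 h2
    have ha := mul_le_mul_of_nonneg_left
      (hdec (mem_Iic.2 h2) (mem_Iic.2 le_rfl) h2) ht
    have hb := mul_le_mul_of_nonneg_left
      (hdec (mem_Iic.2 (h12.le.trans h2)) (mem_Iic.2 h2) h12.le) ht
    have := key (-x₂) (-x₁) (1 + t * u₀ x₂) (1 + t * u₀ x₁)
      (by linarith) (by linarith) (by linarith) (by linarith)
    linarith
end

section
/- Let η ≥ 1 and K, C, ε, M, F > 0. Let g : (0,1] → ℝ satisfy g(x) ≥ K·x^η for all x ∈ (0,1], let h : ℝ → ℝ be continuous with h(w) ≥ C·|w|^{η+ε} whenever |w| > M, and let u : (0,1] → ℝ be measurable with g(x)·h(u(x)) = F for all x ∈ (0,1]. Then u is integrable on (0,1]: ∫₀¹ |u(x)| dx < ∞. (In particular, there are constants C̃ > 0 and θ ∈ (0,1) with |u(x)| ≤ C̃·x^{θ−1} for all sufficiently small x, so the singularity at x = 0 is integrable.) -/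
open MeasureTheory Set

/-- integrability of stationary solutions near a degenerate interface.
If `g(x) ≥ K x^η` on `(0,1]` (order of vanishing), `h(w) ≥ C |w|^{η+ε}` for `|w| > M`
(compensating growth), and `g(x)·h(u(x)) = F > 0` on `(0,1]`, then `u` is integrable
on `(0,1]`; moreover `|u(x)| ≤ C' x^{θ−1}` for some `C' > 0`, `θ ∈ (0,1)` and all
sufficiently small `x ∈ (0,1]`. -/
theorem statement18 (η K C ε M F : ℝ) (hη : 1 ≤ η) (hK : 0 < K) (hC : 0 < C)
    (hε : 0 < ε) (hM : 0 < M) (hF : 0 < F)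
    (g : ℝ → ℝ) (hg : ∀ x ∈ Ioc (0 : ℝ) 1, K * x ^ η ≤ g x)
    (h : ℝ → ℝ) (hhc : Continuous h)
    (hh : ∀ w : ℝ, M < |w| → C * |w| ^ (η + ε) ≤ h w)
    (u : ℝ → ℝ) (hu : Measurable u)
    (huF : ∀ x ∈ Ioc (0 : ℝ) 1, g x * h (u x) = F) :
    IntegrableOn u (Ioc 0 1) volume ∧
    ∃ C' > (0 : ℝ), ∃ θ ∈ Ioo (0 : ℝ) 1, ∃ δ > (0 : ℝ),
      ∀ x ∈ Ioc (0 : ℝ) 1, x ≤ δ → |u x| ≤ C' * x ^ (θ - 1) := by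
  have hp : 0 < η + ε := by linarith
  have hA : 0 < F / (K * C) := by positivity
  have hθ : ε / (η + ε) ∈ Ioo (0 : ℝ) 1 :=
    ⟨by positivity, by rw [div_lt_one hp]; linarith⟩
  have hθ' : ε / (η + ε) - 1 = -η * (η + ε)⁻¹ := by field_simp; ring
  have hC' : 0 < (F / (K * C)) ^ (η + ε)⁻¹ + M := by positivity
  have key : ∀ x ∈ Ioc (0 : ℝ) 1,
      |u x| ≤ ((F / (K * C)) ^ (η + ε)⁻¹ + M) * x ^ (ε / (η + ε) - 1) := by
    intro x hx
    have hx0 : 0 < x := hx.1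
    have h1 : 1 ≤ x ^ (ε / (η + ε) - 1) :=
      Real.one_le_rpow_of_pos_of_le_one_of_nonpos hx.1 hx.2 (by linarith [hθ.2])
    have hA' : 0 < (F / (K * C)) ^ (η + ε)⁻¹ := by positivity
    by_cases hm : M < |u x|
    · have h2 := hh _ hm
      have hxη : 0 < x ^ η := by positivity
      have h3 : (K * x ^ η) * (C * |u x| ^ (η + ε)) ≤ F := by
        rw [← huF x hx]
        exact mul_le_mul (hg x hx) h2 (by positivity)
          (le_trans (by positivity) (hg x hx))
      have h4 : |u x| ^ (η + ε) ≤ F / (K * C) * x ^ (-η) := by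
        rw [Real.rpow_neg hx0.le, ← div_eq_mul_inv, div_div, le_div_iff₀ (by positivity)]
        linarith
      have h5 : |u x| ≤ (F / (K * C) * x ^ (-η)) ^ (η + ε)⁻¹ :=
        (Real.le_rpow_inv_iff_of_pos (abs_nonneg _) (by positivity) hp).2 h4
      rw [Real.mul_rpow hA.le (by positivity), ← Real.rpow_mul hx0.le, ← hθ'] at h5
      nlinarith
    · nlinarith
  refine ⟨?_, _, hC', _, hθ, 1, one_pos, fun x hx _ => key x hx⟩
  have hi : IntegrableOn (fun x : ℝ => ((F / (K * C)) ^ (η + ε)⁻¹ + M) *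
      x ^ (ε / (η + ε) - 1)) (Ioc 0 1) volume := by
    have := (intervalIntegral.intervalIntegrable_rpow' (a := 0) (b := 1)
      (r := ε / (η + ε) - 1) (by linarith [hθ.1])).const_mul
        ((F / (K * C)) ^ (η + ε)⁻¹ + M)
    exact (intervalIntegrable_iff_integrableOn_Ioc_of_le zero_le_one).1 this
  refine Integrable.mono' hi hu.aestronglyMeasurable ?_
  filter_upwards [ae_restrict_mem measurableSet_Ioc] with x hx
  exact key x hx
end

section
/- Let g : ℝ → ℝ be locally Lipschitz with g(0) = 0 and x·g(x) > 0 for all x ≠ 0, and let h ∈ C¹(ℝ) with h(0) = h'(0) = 0 and h' strictly increasing. Let u_r : (0,∞) → (0,∞) satisfy g(x)·h(u_r(x)) = 1 for all x > 0, and let u_l : (−∞,0) → (−∞,0) satisfy g(x)·h(u_l(x)) = −1 for all x < 0, and assume u_l and u_r are locally integrable on ℝ (in particular integrable near 0). Define u : ℝ → ℝ by u(x) = u_l(x) for x < 0, u(x) = u_r(x) for x > 0, u(0) = 0. Then for every k ∈ ℝ and every nonnegative φ ∈ C_c^∞(ℝ × ℝ) with support contained in ℝ × (0,∞): ∫₀^∞∫_ℝ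 [ |u(x) − k| ∂_tφ + sgn(u(x) − k)·(g(x)h(u(x)) − g(x)h(k))·∂_xφ − sgn(u(x) − k)·g'(x)·h(k)·φ ] dx dt = 0, where g' denotes the a.e. derivative of g. That is, the time-independent function (x,t) ↦ u(x) is a stationary solution of u_t + (g(x)h(u))_x = 0 satisfying Kružkov's entropy inequality as an equality. -/
open MeasureTheory Set

lemma ae_diff_of_locLip {F : ℝ → ℝ} (hF : LocallyLipschitz F) :
    ∀ᵐ x : ℝ, DifferentiableAt ℝ F x := by
  have key : ∀ n : ℕ, ∀ᵐ x : ℝ, x ∈ uIcc (-(n : ℝ)) n → DifferentiableAt ℝ F x := by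
    intro n
    obtain ⟨K, hK⟩ := LocallyLipschitzOn.exists_lipschitzOnWith_of_compact
      (isCompact_uIcc (a := -(n : ℝ)) (b := n)) hF.locallyLipschitzOn
    exact hK.absolutelyContinuousOnInterval.ae_differentiableAt
  filter_upwards [ae_all_iff.2 key] with x hx
  obtain ⟨n, hn⟩ := exists_nat_ge |x|
  refine hx n ?_
  rw [uIcc_of_le (by linarith [abs_nonneg x])]
  exact abs_le.1 hn

lemma ibp {F ψ : ℝ → ℝ} (hF : LocallyLipschitz F) (hψ : ContDiff ℝ 1 ψ)
    (hc : HasCompactSupport ψ) :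
    Integrable (fun x => F x * deriv ψ x + deriv F x * ψ x) ∧
    ∫ x, (F x * deriv ψ x + deriv F x * ψ x) = 0 := by
  obtain ⟨R, hR⟩ := (hc.isCompact.isBounded).subset_closedBall 0
  set a : ℝ := |R| + 1 with ha
  have ha0 : 0 < a := by positivity
  have hz : ∀ x, x ∉ Ioo (-a) a → ψ x = 0 ∧ deriv ψ x = 0 := by
    intro x hx
    have : x ∉ tsupport ψ := by
      intro h
      apply hx
      have := hR h
      rw [Metric.mem_closedBall, dist_zero_right, Real.norm_eq_abs] at this
      have h2 := abs_lt.1 (lt_of_le_of_lt (this.trans (le_abs_self R)) (lt_add_one |R|))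
      exact h2
    refine ⟨image_eq_zero_of_notMem_tsupport this, ?_⟩
    by_contra h
    exact this (support_deriv_subset h)
  obtain ⟨K, hK⟩ := LocallyLipschitzOn.exists_lipschitzOnWith_of_compact
      (isCompact_uIcc (a := -a) (b := a)) hF.locallyLipschitzOn
  obtain ⟨K', hK'⟩ := LocallyLipschitzOn.exists_lipschitzOnWith_of_compact
      (isCompact_uIcc (a := -a) (b := a)) hψ.locallyLipschitz.locallyLipschitzOn
  have hA := hK.absolutelyContinuousOnInterval
  have hB := hK'.absolutelyContinuousOnInterval
  have hI : IntervalIntegrable (fun x => F x * deriv ψ x + deriv F x * ψ x) volume (-a) a :=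
    (hB.intervalIntegrable_deriv.continuousOn_mul hA.continuousOn).add
      (hA.intervalIntegrable_deriv.mul_continuousOn hB.continuousOn)
  have hsub : Function.support (fun x => F x * deriv ψ x + deriv F x * ψ x) ⊆ Ioc (-a) a := by
    intro x hx
    by_contra h
    have := hz x (fun h' => h ⟨h'.1, h'.2.le⟩)
    simp [this.1, this.2] at hx
  constructor
  · rw [intervalIntegrable_iff_integrableOn_Ioc_of_le (by linarith)] at hI
    exact (integrableOn_iff_integrable_of_support_subset hsub).1 hI
  · rw [← intervalIntegral.integral_eq_integral_of_support_subset hsub]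
    have h1 := hA.integral_deriv_mul_eq_sub hB
    have h2 := hz a (by simp)
    have h3 := hz (-a) (by simp)
    rw [h2.1, h3.1] at h1
    simp only [add_comm] at h1 ⊢
    simpa using h1

lemma deriv_zero_of_abs {v : ℝ → ℝ} {x : ℝ} (hx : v x = 0)
    (h : DifferentiableAt ℝ (fun y => |v y|) x) :
    deriv (fun y => |v y|) x = 0 ∧ HasDerivAt v 0 x := by
  have h0 : deriv (fun y => |v y|) x = 0 := by
    apply IsLocalMin.deriv_eq_zero
    exact Filter.Eventually.of_forall fun y => by simp [hx]
  refine ⟨h0, ?_⟩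
  have h1 := h.hasDerivAt
  rw [h0, hasDerivAt_iff_isLittleO] at h1
  rw [hasDerivAt_iff_isLittleO]
  simp only [hx, abs_zero, sub_zero, smul_zero] at h1 ⊢
  exact Asymptotics.IsLittleO.of_norm_left (by simpa using h1)

lemma flux (γ T : ℝ → ℝ) (c : ℝ) (hγ : LocallyLipschitz γ) (hT : ∀ x, T x = 1 ∨ T x = -1)
    (h0 : ∀ x, x ≠ 0 → γ x ≠ 0)
    (hp : ∀ x, 0 < γ x → 0 ≤ T x * (1 - γ x * c)) (hn : ∀ x, γ x < 0 → T x = -1) :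
    ∃ F : ℝ → ℝ, LocallyLipschitz F ∧ (∀ x, 0 < γ x → T x * (1 - γ x * c) = F x) ∧
      (∀ x, γ x < 0 → T x * (-1 - γ x * c) = F x) ∧
      ∀ᵐ x : ℝ, - T x * deriv γ x * c = deriv F x := by
  set F : ℝ → ℝ := fun x => |1 - max (γ x) 0 * c| + min (γ x) 0 * c with hFdef
  have hFL : LocallyLipschitz F := by
    have e1 : LocallyLipschitz (fun y : ℝ => |1 - y * c|) :=
      (lipschitzWith_one_norm (E := ℝ)).locallyLipschitz.comp
        (ContDiff.locallyLipschitz (f := fun y : ℝ => 1 - y * c) (𝕂 := ℝ) (by fun_prop))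
    have e2 : LocallyLipschitz (fun y : ℝ => y * c) :=
      ContDiff.locallyLipschitz (𝕂 := ℝ) (by fun_prop)
    have e3 : LocallyLipschitz (fun p : ℝ × ℝ => p.1 + p.2) :=
      ContDiff.locallyLipschitz (𝕂 := ℝ) (by fun_prop)
    exact e3.comp ((e1.comp (hγ.max_const 0)).prodMk (e2.comp (hγ.min_const 0)))
  refine ⟨F, hFL, ?_, ?_, ?_⟩
  · intro x hx
    have := hp x hx
    simp only [hFdef, max_eq_left hx.le, min_eq_right hx.le, zero_mul, add_zero]
    rcases hT x with h | h <;> rw [h] at this ⊢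
    · rw [abs_of_nonneg (by linarith)]; ring
    · rw [abs_of_nonpos (by linarith)]; ring
  · intro x hx
    simp only [hFdef, max_eq_right hx.le, min_eq_left hx.le, zero_mul, hn x hx]
    norm_num
    ring
  · have hne : ∀ᵐ x : ℝ, x ≠ 0 := by
      simp [ae_iff]
    filter_upwards [hne, ae_diff_of_locLip hFL, ae_diff_of_locLip hγ] with x hx hdF hdγ
    have hγc : ContinuousAt γ x := hγ.continuous.continuousAt
    rcases lt_or_gt_of_ne (h0 x hx) with hneg | hpos
    · have hev : F =ᶠ[nhds x] fun y => 1 + γ y * c := by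
        filter_upwards [hγc.eventually_lt_const hneg] with y hy
        simp [hFdef, max_eq_right hy.le, min_eq_left hy.le]
      rw [hev.deriv_eq, hn x hneg]
      have := (hdγ.hasDerivAt.mul_const c).const_add 1
      rw [this.deriv]; ring
    · have hev : F =ᶠ[nhds x] fun y => |1 - γ y * c| := by
        filter_upwards [hγc.eventually_const_lt hpos] with y hy
        simp [hFdef, max_eq_left hy.le, min_eq_right hy.le]
      have hd := (hdγ.hasDerivAt.mul_const c).const_sub 1
      rw [hev.deriv_eq]
      by_cases hz : 1 - γ x * c = 0
      · have hdA : DifferentiableAt ℝ (fun y => |1 - γ y * c|) x := hev.differentiableAt_iff.1 hdF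
        obtain ⟨h1, h2⟩ := deriv_zero_of_abs (v := fun y => 1 - γ y * c) hz hdA
        have h3 := hd.unique h2
        rw [h1]
        linear_combination T x * h3
      · have hp' := hp x hpos
        have hcont : ContinuousAt (fun y => 1 - γ y * c) x := hd.continuousAt
        rcases lt_or_gt_of_ne hz with h | h
        · have : T x = -1 := by
            rcases hT x with h' | h'
            · rw [h'] at hp'; linarith
            · exact h'
          have hev2 : (fun y => |1 - γ y * c|) =ᶠ[nhds x] fun y => -(1 - γ y * c) := by
            filter_upwards [hcont.eventually_lt_const h] with y hy
            exact abs_of_neg hy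
          rw [hev2.deriv_eq, hd.fun_neg.deriv, this]; ring
        · have : T x = 1 := by
            rcases hT x with h' | h'
            · exact h'
            · rw [h'] at hp'; linarith
          have hev2 : (fun y => |1 - γ y * c|) =ᶠ[nhds x] fun y => (1 - γ y * c) := by
            filter_upwards [hcont.eventually_const_lt h] with y hy
            exact abs_of_pos hy
          rw [hev2.deriv_eq, hd.deriv, this]; ring

lemma timePart (w : ℝ → ℝ) (hw : LocallyIntegrable w) (φ : ℝ × ℝ → ℝ)
    (hφ : ContDiff ℝ 1 φ) (hφc : HasCompactSupport φ)
    (hφsupp : tsupport φ ⊆ univ ×ˢ Ioi 0) :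
    (∀ t, Integrable (fun x => w x * fderiv ℝ φ (x, t) (0, 1))) ∧
    ∫ t in Ioi (0 : ℝ), ∫ x : ℝ, w x * fderiv ℝ φ (x, t) (0, 1) = 0 := by
  have hcont : Continuous (fun p => fderiv ℝ φ p (0, 1)) :=
    (hφ.continuous_fderiv one_ne_zero).clm_apply continuous_const
  have hcs : HasCompactSupport (fun p => fderiv ℝ φ p (0, 1)) := hφc.fderiv_apply ℝ (0, 1)
  have hemb : ∀ t : ℝ, Topology.IsClosedEmbedding (fun x : ℝ => (x, t)) := fun t =>
    Topology.IsClosedEmbedding.of_continuous_injective_isClosedMap (by fun_prop)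
      (fun a b h => (Prod.mk.inj h).1) (isClosedMap_prodMk_right t)
  have hemb' : ∀ x : ℝ, Topology.IsClosedEmbedding (fun t : ℝ => (x, t)) := fun t =>
    Topology.IsClosedEmbedding.of_continuous_injective_isClosedMap (by fun_prop)
      (fun a b h => (Prod.mk.inj h).2) (isClosedMap_prodMk_left t)
  constructor
  · intro t
    have := hw.integrable_smul_left_of_hasCompactSupport
      (g := fun x => fderiv ℝ φ (x, t) (0, 1)) (by fun_prop)
      (hcs.comp_isClosedEmbedding (hemb t))
    simpa [mul_comm] using this
  · have hint : Integrable (fun p : ℝ × ℝ => w p.1 * fderiv ℝ φ p (0, 1))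
        (volume.prod (volume.restrict (Ioi 0))) := by
      have hK1 : IsCompact (Prod.fst '' tsupport (fun p => fderiv ℝ φ p (0, 1))) :=
        hcs.isCompact.image continuous_fst
      have hK2 : IsCompact (Prod.snd '' tsupport (fun p => fderiv ℝ φ p (0, 1))) :=
        hcs.isCompact.image continuous_snd
      set K1 := Prod.fst '' tsupport (fun p => fderiv ℝ φ p (0, 1))
      set K2 := Prod.snd '' tsupport (fun p => fderiv ℝ φ p (0, 1))
      have i1 : Integrable (K1.indicator w) :=
        (hw.integrableOn_isCompact hK1).integrable_indicator hK1.measurableSet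
      have i2 : Integrable (K2.indicator (fun _ => (1 : ℝ))) (volume.restrict (Ioi 0)) := by
        apply Integrable.mono_measure (ν := volume) _ Measure.restrict_le_self
        exact (integrable_indicator_iff hK2.measurableSet).2
          (integrableOn_const (by exact hK2.measure_lt_top.ne))
      obtain ⟨C, hC⟩ := hcont.bounded_above_of_compact_support hcs
      have := (i1.mul_prod i2).mul_bdd (c := C) hcont.aestronglyMeasurable
        (Filter.Eventually.of_forall hC)
      refine this.congr (Filter.Eventually.of_forall fun p => ?_)
      by_cases hp : p ∈ tsupport (fun p => fderiv ℝ φ p (0, 1))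
      · have h1 : p.1 ∈ K1 := mem_image_of_mem _ hp
        have h2 : p.2 ∈ K2 := mem_image_of_mem _ hp
        simp [h1, h2]
      · have := image_eq_zero_of_notMem_tsupport hp
        simp [this]
    rw [← integral_integral_swap (f := fun x t => w x * fderiv ℝ φ (x, t) (0, 1)) hint]
    have : ∀ x : ℝ, ∫ t in Ioi (0 : ℝ), w x * fderiv ℝ φ (x, t) (0, 1) = 0 := by
      intro x
      rw [integral_const_mul]
      have hd : ∀ t, HasDerivAt (fun t => φ (x, t)) (fderiv ℝ φ (x, t) (0, 1)) t := fun t =>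
        ((hφ.differentiable one_ne_zero (x, t)).hasFDerivAt).comp_hasDerivAt t
          ((hasDerivAt_const t x).prodMk (hasDerivAt_id t))
      have h1 := HasCompactSupport.integral_Ioi_deriv_eq (f := fun t => φ (x, t))
        (hφ.comp (by fun_prop)) (hφc.comp_isClosedEmbedding (hemb' x)) 0
      have h2 : φ (x, 0) = 0 := image_eq_zero_of_notMem_tsupport fun h => by
        have := hφsupp h
        simp at this
      simp only [fun t => (hd t).deriv, h2] at h1
      rw [h1]; simp
    simp [this]

/-- the glued stationary profile (negative branch `u_l` with flux `−1` on
`x < 0`, positive branch `u_r` with flux `+1` on `x > 0`, `0` at the interface) is a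
stationary solution of `u_t + (g(x)h(u))_x = 0` satisfying Kružkov's entropy inequality
as an *equality*: for every `k ∈ ℝ` and every nonnegative smooth compactly supported
test function supported in `ℝ × (0,∞)`, the Kružkov integral vanishes. Here `deriv g`
is the a.e. derivative of the locally Lipschitz function `g`. -/
theorem statement19 (g h : ℝ → ℝ) (hg : LocallyLipschitz g) (hg0 : g 0 = 0)
    (hsign : ∀ x : ℝ, x ≠ 0 → 0 < x * g x)
    (hh : ContDiff ℝ 1 h) (hh0 : h 0 = 0) (hh0' : deriv h 0 = 0)
    (hmono : StrictMono (deriv h))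
    (ur ul : ℝ → ℝ)
    (hur_pos : ∀ x : ℝ, 0 < x → 0 < ur x)
    (hur : ∀ x : ℝ, 0 < x → g x * h (ur x) = 1)
    (hul_neg : ∀ x : ℝ, x < 0 → ul x < 0)
    (hul : ∀ x : ℝ, x < 0 → g x * h (ul x) = -1)
    (u : ℝ → ℝ)
    (hu : ∀ x : ℝ, u x = if x < 0 then ul x else if 0 < x then ur x else 0)
    (hint : LocallyIntegrable u)
    (k : ℝ) (φ : ℝ × ℝ → ℝ) (hφ : ContDiff ℝ (⊤ : ℕ∞) φ) (hφc : HasCompactSupport φ)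
    (hφpos : ∀ p, 0 ≤ φ p) (hφsupp : tsupport φ ⊆ univ ×ˢ Ioi 0) :
    (∫ t in Ioi (0 : ℝ), ∫ x : ℝ,
      (|u x - k| * fderiv ℝ φ (x, t) (0, 1)
        + sgn (u x - k) * (g x * h (u x) - g x * h k) * fderiv ℝ φ (x, t) (1, 0)
        - sgn (u x - k) * deriv g x * h k * φ (x, t))) = 0 := by
  have hφ1 : ContDiff ℝ 1 φ := hφ.of_le (by exact_mod_cast le_top)
  have hcd : Continuous h := hh.continuous
  have hinc : StrictMonoOn h (Ici 0) := by
    apply strictMonoOn_of_deriv_pos (convex_Ici 0) hcd.continuousOn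
    intro x hx
    rw [interior_Ici] at hx
    rw [← hh0']; exact hmono hx
  have hdec : StrictAntiOn h (Iic 0) := by
    apply strictAntiOn_of_deriv_neg (convex_Iic 0) hcd.continuousOn
    intro x hx
    rw [interior_Iic] at hx
    rw [← hh0']; exact hmono hx
  have gpos : ∀ x, 0 < x → 0 < g x := fun x hx => by
    have := hsign x hx.ne'
    exact (mul_pos_iff_of_pos_left hx).1 this
  have gneg : ∀ x, x < 0 → g x < 0 := fun x hx => by
    have := hsign x hx.ne
    by_contra h'
    nlinarith
  have xpos : ∀ x, 0 < g x → 0 < x := fun x hx => by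
    rcases lt_trichotomy x 0 with h1 | h1 | h1
    · linarith [gneg x h1]
    · rw [h1, hg0] at hx; exact absurd hx (lt_irrefl _)
    · exact h1
  have xneg : ∀ x, g x < 0 → x < 0 := fun x hx => by
    rcases lt_trichotomy x 0 with h1 | h1 | h1
    · exact h1
    · rw [h1, hg0] at hx; exact absurd hx (lt_irrefl _)
    · linarith [gpos x h1]
  have gne : ∀ x, x ≠ 0 → g x ≠ 0 := fun x hx h' => by
    have := hsign x hx
    rw [h'] at this; simp at this
  have uP : ∀ x, 0 < x → 0 < u x ∧ g x * h (u x) = 1 := fun x hx => by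
    rw [hu x, if_neg (not_lt.2 hx.le), if_pos hx]
    exact ⟨hur_pos x hx, hur x hx⟩
  have uN : ∀ x, x < 0 → u x < 0 ∧ g x * h (u x) = -1 := fun x hx => by
    rw [hu x, if_pos hx]
    exact ⟨hul_neg x hx, hul x hx⟩
  have hsgn : ∀ s, sgn s = 1 ∨ sgn s = -1 := fun s => by
    unfold sgn; split_ifs <;> simp
  have hF : ∃ F : ℝ → ℝ, LocallyLipschitz F ∧
      (∀ᵐ x : ℝ, sgn (u x - k) * (g x * h (u x) - g x * h k) = F x) ∧
      ∀ᵐ x : ℝ, - (sgn (u x - k) * deriv g x * h k) = deriv F x := by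
    have hne : ∀ᵐ x : ℝ, x ≠ 0 := by simp [ae_iff]
    rcases le_or_gt 0 k with hk | hk
    · obtain ⟨F, hFL, h1, h2, h3⟩ := flux g (fun x => sgn (u x - k)) (h k) hg
        (fun x => hsgn _) gne
        (by
          intro x hx
          obtain ⟨a, b⟩ := uP x (xpos x hx)
          rw [← b, ← mul_sub]
          simp only [sgn]
          split_ifs with hs
          · have := hinc.monotoneOn (mem_Ici.2 hk) (mem_Ici.2 a.le) (by linarith)
            have := mul_nonneg hx.le (sub_nonneg.2 this)
            linarith
          · have := hinc.monotoneOn (mem_Ici.2 a.le) (mem_Ici.2 hk) (by linarith)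
            have := mul_nonneg hx.le (sub_nonneg.2 this)
            linarith)
        (by
          intro x hx
          obtain ⟨a, b⟩ := uN x (xneg x hx)
          simp only [sgn]
          rw [if_neg (by linarith)])
      refine ⟨F, hFL, ?_, ?_⟩
      · filter_upwards [hne] with x hx
        rcases lt_or_gt_of_ne hx with hx | hx
        · rw [(uN x hx).2]; exact h2 x (gneg x hx)
        · rw [(uP x hx).2]; exact h1 x (gpos x hx)
      · filter_upwards [h3] with x hx
        rw [← hx]; ring
    · obtain ⟨F, hFL, h1, h2, h3⟩ := flux (fun x => - g x) (fun x => - sgn (u x - k)) (h k)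
        ((LipschitzWith.id.neg (α := ℝ)).locallyLipschitz.comp hg)
        (fun x => by rcases hsgn (u x - k) with h | h <;> simp [h])
        (fun x hx => neg_ne_zero.2 (gne x hx))
        (by
          intro x hx
          have hx' : g x < 0 := by linarith
          obtain ⟨a, b⟩ := uN x (xneg x hx')
          have e : 1 - -g x * h k = - (g x * (h (u x) - h k)) := by rw [mul_sub, b]; ring
          rw [e]
          simp only [sgn]
          split_ifs with hs
          · have := hdec.antitoneOn (mem_Iic.2 hk.le) (mem_Iic.2 a.le) (by linarith)
            have := mul_nonneg hx.le (sub_nonneg.2 this)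
            linarith
          · have := hdec.antitoneOn (mem_Iic.2 a.le) (mem_Iic.2 hk.le) (by linarith)
            have := mul_nonneg hx.le (sub_nonneg.2 this)
            linarith)
        (by
          intro x hx
          obtain ⟨a, b⟩ := uP x (xpos x (by linarith))
          simp only [sgn]
          rw [if_pos (by linarith)])
      refine ⟨F, hFL, ?_, ?_⟩
      · filter_upwards [hne] with x hx
        rcases lt_or_gt_of_ne hx with hx | hx
        · rw [(uN x hx).2, ← h1 x (by linarith [gneg x hx])]; ring
        · rw [(uP x hx).2, ← h2 x (by linarith [gpos x hx])]; ring
      · filter_upwards [h3] with x hx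
        rw [← hx, deriv.fun_neg]; ring
  obtain ⟨F, hFL, hF1, hF2⟩ := hF
  have hw : LocallyIntegrable (fun x => |u x - k|) :=
    fun x => ((hint.sub (locallyIntegrable_const k)) x).norm
  obtain ⟨ht1, ht2⟩ := timePart _ hw φ hφ1 hφc hφsupp
  have hsp : ∀ t : ℝ, ∫ x : ℝ,
      (|u x - k| * fderiv ℝ φ (x, t) (0, 1)
        + sgn (u x - k) * (g x * h (u x) - g x * h k) * fderiv ℝ φ (x, t) (1, 0)
        - sgn (u x - k) * deriv g x * h k * φ (x, t))
      = ∫ x : ℝ, |u x - k| * fderiv ℝ φ (x, t) (0, 1) := by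
    intro t
    have hemb : Topology.IsClosedEmbedding (fun x : ℝ => (x, t)) :=
      Topology.IsClosedEmbedding.of_continuous_injective_isClosedMap (by fun_prop)
        (fun a b h => (Prod.mk.inj h).1) (isClosedMap_prodMk_right t)
    obtain ⟨i1, i2⟩ := ibp (ψ := fun x => φ (x, t)) hFL (hφ1.comp (by fun_prop))
      (hφc.comp_isClosedEmbedding hemb)
    have hd : ∀ x, HasDerivAt (fun x => φ (x, t)) (fderiv ℝ φ (x, t) (1, 0)) x := fun x =>
      ((hφ1.differentiable one_ne_zero (x, t)).hasFDerivAt).comp_hasDerivAt x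
        ((hasDerivAt_id x).prodMk (hasDerivAt_const x t))
    have := integral_add (ht1 t) i1
    rw [i2, add_zero] at this
    rw [← this]
    apply integral_congr_ae
    filter_upwards [hF1, hF2] with x h1 h2
    rw [← h1, ← h2, (hd x).deriv]
    ring
  simp only [hsp]
  exact ht2
end
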